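/- arXiv:1712.06392 — 3 statements merged into one kernel-verified Lean document; each statement's English description precedes it below -/
import Mathlib

section
/- Let K be an algebraically closed field with char(K) ≠ 2, 3 and R = K[x1,…,x7]. There exists a homogeneous ideal I ⊆ R such that: (i) the graded K-algebra A = R/I has Hilbert function (1,7,7,1) and is Gorenstein; (ii) A is smoothable (with d = 16); and (iii) the K-vector space of R-module homomorphisms Hom_R(I, R/I) has dimension 112 over K. -/
open TensorProduct in
/-- A commutative `K`-algebra `A` (of dimension `d`) is *smoothable* if there is a commutative
`K[[t]]`-algebra `B`, free of rank `d` as a `K[[t]]`-module, with `B/(t)B ≅ A` as a `K`-algebra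
and `B ⊗_{K[[t]]} K((t))` étale over the Laurent series field `K((t))`. -/
def IsSmoothable (K : Type) [Field K] (A : Type) [CommRing A] [Algebra K A] (d : ℕ) : Prop :=
  ∃ (B : Type) (_ : CommRing B) (_ : Algebra (PowerSeries K) B) (_ : Algebra K B)
    (_ : IsScalarTower K (PowerSeries K) B),
    Module.Free (PowerSeries K) B ∧
    Module.finrank (PowerSeries K) B = d ∧
    Nonempty ((B ⧸ Ideal.span {(algebraMap (PowerSeries K) B) PowerSeries.X}) ≃ₐ[K] A) ∧
    Algebra.Etale (LaurentSeries K) ((LaurentSeries K) ⊗[PowerSeries K] B)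

/-- The degree-`t` graded piece of `R/I`: the image in `R/I` of the space of
degree-`t` homogeneous polynomials. -/
noncomputable def gradedPiece (K : Type) [Field K] (n : ℕ)
    (I : Ideal (MvPolynomial (Fin n) K)) (t : ℕ) :
    Submodule K (MvPolynomial (Fin n) K ⧸ I) :=
  Submodule.map (Ideal.Quotient.mkₐ K I).toLinearMap (MvPolynomial.homogeneousSubmodule (Fin n) K t)

/-- The socle of `A = R/I`: the subspace `{a ∈ A : a · x̄ᵢ = 0 for all i}`. -/
noncomputable def socle (K : Type) [Field K] (n : ℕ) (I : Ideal (MvPolynomial (Fin n) K)) :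
    Submodule K (MvPolynomial (Fin n) K ⧸ I) :=
  ⨅ i : Fin n, LinearMap.ker (LinearMap.mulRight K (Ideal.Quotient.mk I (MvPolynomial.X i)))

namespace SmoothPoint

theorem finrank_cotangent_add (K : Type*) {R : Type*} [Field K] [CommRing R] [Algebra K R]
    (I : Ideal R) [FiniteDimensional K (R ⧸ I ^ 2)] :
    Module.finrank K I.Cotangent + Module.finrank K (R ⧸ I) = Module.finrank K (R ⧸ I ^ 2) := by
  have hle : I ^ 2 ≤ I := Ideal.pow_le_self two_ne_zero
  let π := (Ideal.Quotient.factorₐ K hle).toLinearMap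
  have hsurj : Function.Surjective π := Ideal.Quotient.factor_surjective hle
  have hinj := I.cotangentToQuotientSquare_injective
  have hrank := LinearMap.finrank_range_add_finrank_ker π
  rw [LinearMap.range_eq_top.2 hsurj, finrank_top] at hrank
  have hker : LinearMap.range (I.cotangentToQuotientSquare.restrictScalars K) = LinearMap.ker π := by
    ext y
    obtain ⟨y, rfl⟩ := Ideal.Quotient.mk_surjective y
    rw [LinearMap.mem_ker]
    change _ ↔ Ideal.Quotient.mk I y = 0
    rw [Ideal.Quotient.eq_zero_iff_mem, LinearMap.mem_range]
    constructor
    · rintro ⟨x, hx⟩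
      obtain ⟨x, rfl⟩ := I.toCotangent_surjective x
      have hxy : (x : R) - y ∈ I ^ 2 := Ideal.Quotient.eq.1 hx
      simpa using I.sub_mem x.2 (hle hxy)
    · exact fun hy => ⟨I.toCotangent ⟨y, hy⟩, rfl⟩
  rw [← hker, LinearMap.finrank_range_of_inj
    (f := I.cotangentToQuotientSquare.restrictScalars K) hinj] at hrank
  omega

theorem finrank_hom_quotient_add (K : Type*) {R : Type*} [Field K] [CommRing R] [Algebra K R]
    (I : Ideal R) [FiniteDimensional K (R ⧸ I)] [FiniteDimensional K (R ⧸ I ^ 2)]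
    (φ : (R ⧸ I) →ₗ[K] K) (hφ : ∀ a, (∀ b, φ (b * a) = 0) → a = 0) :
    Module.finrank K (I →ₗ[R] R ⧸ I) + Module.finrank K (R ⧸ I) =
      Module.finrank K (R ⧸ I ^ 2) := by
  have : FiniteDimensional K I.Cotangent := FiniteDimensional.of_injective
    (I.cotangentToQuotientSquare.restrictScalars K) I.cotangentToQuotientSquare_injective
  let D : (R ⧸ I) →ₗ[K] Module.Dual K (R ⧸ I) :=
    LinearMap.mk₂ K (fun a b => φ (b * a)) (by intros; simp [mul_add]) (by intros; simp)
      (by intros; simp [add_mul]) (by intros; simp)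
  have hDinj : Function.Injective D := by
    rw [← LinearMap.ker_eq_bot, LinearMap.ker_eq_bot']
    exact fun a ha => hφ a fun b => LinearMap.congr_fun ha b
  have hDsurj : Function.Surjective D :=
    (LinearMap.injective_iff_surjective_of_finrank_eq_finrank Subspace.dual_finrank_eq.symm).1 hDinj
  have hmul (ψ : I →ₗ[R] R ⧸ I) (x y : I) : ψ (x * y) = 0 := by
    rw [show x * y = (x : R) • y from rfl, map_smul, Algebra.smul_def,
      Ideal.Quotient.algebraMap_eq, Ideal.Quotient.eq_zero_iff_mem.2 x.2, zero_mul]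
  let F : (I →ₗ[R] R ⧸ I) →ₗ[K] Module.Dual K I.Cotangent :=
    { toFun := fun ψ => Ideal.Cotangent.lift (φ ∘ₗ ψ.restrictScalars K) fun x y => by
        simp [hmul]
      map_add' := fun ψ χ => LinearMap.ext fun x => by
        obtain ⟨x, rfl⟩ := I.toCotangent_surjective x
        simp
      map_smul' := fun c ψ => LinearMap.ext fun x => by
        obtain ⟨x, rfl⟩ := I.toCotangent_surjective x
        simp }
  have hF (ψ : I →ₗ[R] R ⧸ I) (x : I) : F ψ (I.toCotangent x) = φ (ψ x) := rfl
  have hFinj : Function.Injective F := by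
    rw [← LinearMap.ker_eq_bot, LinearMap.ker_eq_bot']
    refine fun ψ hψ => LinearMap.ext fun x => hφ _ fun b => ?_
    obtain ⟨b, rfl⟩ := Ideal.Quotient.mk_surjective b
    have := LinearMap.congr_fun hψ (I.toCotangent (b • x))
    rwa [hF, map_smul, Algebra.smul_def] at this
  have : IsScalarTower K (R ⧸ I) I.Cotangent := IsScalarTower.of_algebraMap_smul fun c x => by
    rw [IsScalarTower.algebraMap_apply K R (R ⧸ I), algebraMap_smul, algebraMap_smul]
  have hFsurj : Function.Surjective F := by
    intro l
    have hl (x : I.Cotangent) : ∃ a, ∀ b : R ⧸ I, φ (b * a) = l (b • x) := by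
      obtain ⟨a, ha⟩ := hDsurj (l ∘ₗ (LinearMap.toSpanSingleton (R ⧸ I) _ x).restrictScalars K)
      exact ⟨a, fun b => LinearMap.congr_fun ha b⟩
    choose u hu using hl
    have hext (a a' : R ⧸ I) (h : ∀ b, φ (b * a) = φ (b * a')) : a = a' :=
      hDinj (LinearMap.ext h)
    let ψ : I →ₗ[R] R ⧸ I :=
      { toFun := fun x => u (I.toCotangent x)
        map_add' := fun x y => hext _ _ fun b => by simp [mul_add, hu]
        map_smul' := fun r x => hext _ _ fun b => by
          rw [RingHom.id_apply, Algebra.smul_def, ← mul_assoc, hu, hu, I.toCotangent.map_smul,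
            mul_smul]
          rfl }
    refine ⟨ψ, LinearMap.ext fun x => ?_⟩
    obtain ⟨x, rfl⟩ := I.toCotangent_surjective x
    have := hu (I.toCotangent x) 1
    rwa [one_mul, one_smul] at this
  rw [(LinearEquiv.ofBijective F ⟨hFinj, hFsurj⟩).finrank_eq, Subspace.dual_finrank_eq,
    finrank_cotangent_add]

open TensorProduct

theorem kaehlerDifferential_D_eq_zero_of_pow_eq_algebraMap {L A : Type*} [CommRing L] [CommRing A]
    [Algebra L A] {N : ℕ} (hN : IsUnit (N : L)) {x : L} (hx : IsUnit x) {u : A}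
    (h : u ^ N = algebraMap L A x) : KaehlerDifferential.D L A u = 0 := by
  rcases Nat.eq_zero_or_pos N with rfl | hN0
  · rw [Nat.cast_zero, isUnit_zero_iff] at hN
    rw [← one_smul L (KaehlerDifferential.D L A u), ← hN, zero_smul]
  have hD : KaehlerDifferential.D L A (u ^ N) = 0 := by rw [h, Derivation.map_algebraMap]
  rw [Derivation.leibniz_pow] at hD
  have hu := congrArg (u • ·) hD
  simp only [smul_zero, smul_comm u N, smul_smul] at hu
  rwa [← pow_succ', Nat.sub_add_cancel hN0, h, algebraMap_smul, ← Nat.cast_smul_eq_nsmul L,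
    smul_smul, (hN.mul hx).smul_eq_zero] at hu

theorem etale_of_kaehlerDifferential_D_eq_zero {L A : Type*} [Field L] [CommRing A] [Algebra L A]
    [Module.Finite L A] (h : ∀ a, KaehlerDifferential.D L A a = 0) : Algebra.Etale L A := by
  have : Algebra.FormallyUnramified L A := ⟨by
    rw [← Submodule.subsingleton_iff A, ← subsingleton_iff_bot_eq_top,
      ← KaehlerDifferential.span_range_derivation L A, eq_comm, Submodule.span_eq_bot]
    rintro _ ⟨a, rfl⟩
    exact h a⟩
  have : Algebra.FormallyEtale L A := .of_formallyUnramified_of_field _ _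
  have : Algebra.FinitePresentation L A := Algebra.FinitePresentation.of_finiteType.1 inferInstance
  exact { }

section FilteredOrder

variable (K : Type) [Field K] {G : Type} [AddCommGroup G] (d : G → ℕ)
  (h0 : d 0 = 0) (hd : ∀ g h, d (g + h) ≤ d g + d h)

/-- The `K⟦X⟧`-order in the group algebra of `G` spanned by the elements `X ^ d g • g`. -/
def filteredOrder : Subalgebra (PowerSeries K) (AddMonoidAlgebra (PowerSeries K) G) where
  carrier := {b | ∀ g, PowerSeries.X ^ d g ∣ b.coeff g}
  mul_mem' := by
    classical
    intro a b ha hb g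
    rw [AddMonoidAlgebra.coeff_mul]
    refine Finset.dvd_sum fun g₁ _ => Finset.dvd_sum fun g₂ _ => ?_
    dsimp only
    split_ifs with h
    · subst h
      refine (pow_dvd_pow _ (hd g₁ g₂)).trans ?_
      rw [pow_add]
      exact mul_dvd_mul (ha g₁) (hb g₂)
    · exact dvd_zero _
  add_mem' := fun ha hb g => by
    rw [AddMonoidAlgebra.coeff_add]
    exact dvd_add (ha g) (hb g)
  algebraMap_mem' := fun r g => by
    classical
    rw [AddMonoidAlgebra.coe_algebraMap, Function.comp_apply, AddMonoidAlgebra.coeff_single,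
      Finsupp.single_apply]
    split_ifs with h
    · simp [← h, h0]
    · exact dvd_zero _

variable {K d h0 hd}

theorem mem_filteredOrder {b : AddMonoidAlgebra (PowerSeries K) G} :
    b ∈ filteredOrder K d h0 hd ↔ ∀ g, PowerSeries.X ^ d g ∣ b.coeff g := Iff.rfl

theorem single_mem_filteredOrder {g : G} {r : PowerSeries K} (h : PowerSeries.X ^ d g ∣ r) :
    AddMonoidAlgebra.single g r ∈ filteredOrder K d h0 hd := fun g' => by
  classical
  rw [AddMonoidAlgebra.coeff_single, Finsupp.single_apply]
  split_ifs with h'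
  · exact h' ▸ h
  · exact dvd_zero _

variable (K d h0 hd) in
/-- The element `X ^ d g • g` of `filteredOrder`. -/
noncomputable def homogeneousUnit (g : G) : filteredOrder K d h0 hd :=
  ⟨AddMonoidAlgebra.single g (PowerSeries.X ^ d g), single_mem_filteredOrder dvd_rfl⟩

theorem coeff_sum_smul_homogeneousUnit [Fintype G] (c : G → PowerSeries K) (g : G) :
    (∑ h, c h • homogeneousUnit K d h0 hd h : filteredOrder K d h0 hd).1.coeff g =
      c g * PowerSeries.X ^ d g := by
  classical
  rw [AddSubmonoidClass.coe_finsetSum, AddMonoidAlgebra.coeff_sum, Finsupp.finsetSum_apply]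
  simp only [homogeneousUnit, SetLike.mk_smul_mk, AddMonoidAlgebra.smul_single, smul_eq_mul,
    AddMonoidAlgebra.coeff_single, Finsupp.single_apply, Finset.sum_ite_eq', Finset.mem_univ,
    if_true]

variable (K d h0 hd) in
/-- The coordinate isomorphism for the basis `homogeneousUnit`. -/
noncomputable def filteredOrderEquiv [Fintype G] :
    (G → PowerSeries K) ≃ₗ[PowerSeries K] filteredOrder K d h0 hd :=
  LinearEquiv.ofBijective (Fintype.linearCombination (PowerSeries K) (homogeneousUnit K d h0 hd)) <|
  by
    constructor
    · refine fun c c' h => funext fun g => ?_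
      have := congrArg (fun b : filteredOrder K d h0 hd => b.1.coeff g) h
      simp only [Fintype.linearCombination_apply, coeff_sum_smul_homogeneousUnit] at this
      exact mul_right_cancel₀ (pow_ne_zero _ PowerSeries.X_ne_zero) this
    · intro b
      choose c hc using fun g => (mem_filteredOrder.1 b.2) g
      refine ⟨c, Subtype.ext (AddMonoidAlgebra.ext <| Finsupp.ext fun g => ?_)⟩
      rw [Fintype.linearCombination_apply, coeff_sum_smul_homogeneousUnit, hc, mul_comm]

theorem filteredOrderEquiv_apply [Fintype G] (c : G → PowerSeries K) :
    filteredOrderEquiv K d h0 hd c = ∑ g, c g • homogeneousUnit K d h0 hd g := rfl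

instance [Finite G] : Module.Free (PowerSeries K) (filteredOrder K d h0 hd) :=
  have := Fintype.ofFinite G
  .of_equiv (filteredOrderEquiv K d h0 hd)

instance [Finite G] : Module.Finite (PowerSeries K) (filteredOrder K d h0 hd) :=
  have := Fintype.ofFinite G
  .equiv (filteredOrderEquiv K d h0 hd)

theorem finrank_filteredOrder [Finite G] :
    Module.finrank (PowerSeries K) (filteredOrder K d h0 hd) = Nat.card G := by
  have := Fintype.ofFinite G
  rw [← (filteredOrderEquiv K d h0 hd).finrank_eq, Module.finrank_fintype_fun_eq_card,
    Nat.card_eq_fintype_card]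

theorem mem_span_X_iff {b : filteredOrder K d h0 hd} :
    b ∈ Ideal.span {algebraMap (PowerSeries K) (filteredOrder K d h0 hd) PowerSeries.X} ↔
      ∀ g, PowerSeries.coeff (d g) (b.1.coeff g) = 0 := by
  have hX (a : filteredOrder K d h0 hd) (g : G) :
      (algebraMap (PowerSeries K) (filteredOrder K d h0 hd) PowerSeries.X * a).1.coeff g =
        PowerSeries.X * a.1.coeff g := by
    rw [← Algebra.smul_def]
    rfl
  rw [Ideal.mem_span_singleton']
  constructor
  · rintro ⟨a, rfl⟩ g
    obtain ⟨r, hr⟩ := mem_filteredOrder.1 a.2 g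
    rw [mul_comm, hX, hr, ← mul_assoc, ← pow_succ', PowerSeries.coeff_of_lt_order]
    refine lt_of_lt_of_le ?_ (PowerSeries.le_order_mul ..)
    rw [PowerSeries.order_X_pow]
    exact lt_of_lt_of_le (by exact_mod_cast Nat.lt_succ_self _) le_self_add
  · intro h
    have hdvd (g : G) : PowerSeries.X * PowerSeries.X ^ d g ∣ b.1.coeff g := by
      rw [← pow_succ', PowerSeries.X_pow_dvd_iff]
      intro k hk
      rcases Nat.lt_succ_iff_lt_or_eq.1 hk with hk | rfl
      · exact PowerSeries.X_pow_dvd_iff.1 (mem_filteredOrder.1 b.2 g) k hk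
      · exact h g
    choose c hc using hdvd
    refine ⟨⟨AddMonoidAlgebra.ofCoeff (Finsupp.ofSupportFinite
      (fun g => PowerSeries.X ^ d g * c g) (b.1.coeff.support.finite_toSet.subset fun g hg => ?_)),
      fun g => ⟨c g, rfl⟩⟩, Subtype.ext (AddMonoidAlgebra.ext <| Finsupp.ext fun g => ?_)⟩
    · rw [Function.mem_support] at hg
      rw [Finset.mem_coe, Finsupp.mem_support_iff, hc, mul_assoc]
      exact mul_ne_zero PowerSeries.X_ne_zero hg
    · rw [mul_comm, hX, hc, mul_assoc]
      rfl

theorem etale_filteredOrder [Finite G] {N : ℕ} (hG : ∀ g : G, N • g = 0) (hN : (N : K) ≠ 0) :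
    Algebra.Etale (LaurentSeries K) (LaurentSeries K ⊗[PowerSeries K] filteredOrder K d h0 hd) := by
  have := Fintype.ofFinite G
  refine etale_of_kaehlerDifferential_D_eq_zero fun a => ?_
  have hunit (g : G) : KaehlerDifferential.D (LaurentSeries K)
      (LaurentSeries K ⊗[PowerSeries K] filteredOrder K d h0 hd)
      (1 ⊗ₜ homogeneousUnit K d h0 hd g) = 0 := by
    have hNL : (N : LaurentSeries K) ≠ 0 := by
      rw [← map_natCast (algebraMap K (LaurentSeries K))]
      exact (map_ne_zero _).2 hN
    have hx : algebraMap (PowerSeries K) (LaurentSeries K) (PowerSeries.X ^ (d g * N)) ≠ 0 := by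
      rw [ne_eq, FaithfulSMul.algebraMap_eq_zero_iff]
      exact pow_ne_zero _ PowerSeries.X_ne_zero
    refine kaehlerDifferential_D_eq_zero_of_pow_eq_algebraMap hNL.isUnit hx.isUnit ?_
    have : homogeneousUnit K d h0 hd g ^ N =
        algebraMap (PowerSeries K) _ (PowerSeries.X ^ (d g * N)) := by
      apply Subtype.ext
      simp [homogeneousUnit, AddMonoidAlgebra.single_pow, hG, pow_mul,
        AddMonoidAlgebra.coe_algebraMap]
    rw [Algebra.TensorProduct.tmul_pow, one_pow, this, Algebra.TensorProduct.algebraMap_apply,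
      Algebra.algebraMap_eq_smul_one, TensorProduct.tmul_smul, TensorProduct.smul_tmul',
      ← Algebra.algebraMap_eq_smul_one]
    rfl
  induction a with
  | zero => exact map_zero _
  | add a b ha hb => rw [map_add, ha, hb, add_zero]
  | tmul l b =>
    obtain ⟨c, rfl⟩ := (filteredOrderEquiv K d h0 hd).surjective b
    have : l ⊗ₜ (filteredOrderEquiv K d h0 hd c) =
        ∑ g, (c g • l) • ((1 : LaurentSeries K) ⊗ₜ[PowerSeries K] homogeneousUnit K d h0 hd g) := by
      rw [filteredOrderEquiv_apply, TensorProduct.tmul_sum]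
      refine Finset.sum_congr rfl fun g _ => ?_
      rw [TensorProduct.tmul_smul, TensorProduct.smul_tmul', TensorProduct.smul_tmul', smul_eq_mul,
        mul_one]
    rw [this, map_sum]
    refine Finset.sum_eq_zero fun g _ => ?_
    rw [Derivation.map_smul, hunit, smul_zero]

end FilteredOrder

open MvPolynomial

/-- The grading group. -/
abbrev Grp := ZMod 2 × ZMod 2 × ZMod 4

/-- The degrees of the seven variables. -/
def wt : Fin 7 → Grp :=
  ![(0, 0, 3), (0, 1, 1), (1, 0, 1), (1, 1, 1), (0, 1, 2), (1, 0, 2), (1, 1, 2)]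

/-- The degree of the socle generator. -/
def top : Grp := (0, 0, 1)

/-- The number of variables needed to write an element of `Grp`. -/
def depth (g : Grp) : ℕ :=
  if g = 0 then 0 else if g = top then 3 else if ∃ i, wt i = g then 1 else 2

/-- The degree of the monomial indexed by a multiset. -/
def weight (s : Multiset (Fin 7)) : Grp := (s.map wt).sum

@[simp] theorem weight_add (s t : Multiset (Fin 7)) : weight (s + t) = weight s + weight t := by
  simp [weight]

@[simp] theorem weight_cons (i : Fin 7) (s : Multiset (Fin 7)) :
    weight (i ::ₘ s) = wt i + weight s := by
  simp [weight]

theorem depth_zero : depth 0 = 0 := by decide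

theorem depth_add_le : ∀ g h, depth (g + h) ≤ depth g + depth h := by decide +kernel

theorem depth_le (g : Grp) : depth g ≤ 3 := by
  unfold depth
  split_ifs <;> decide

theorem depth_top_sub : ∀ g, depth (top - g) + depth g = 3 := by decide +kernel

theorem exists_depth_add : ∀ g, g ≠ top → ∃ i, depth (g + wt i) = 1 + depth g := by
  decide +kernel

theorem wt_injective : Function.Injective wt := by decide

theorem depth_wt : ∀ i, depth (wt i) = 1 := by decide

theorem exists_word (g : Grp) : ∃ s, weight s = g ∧ s.card = depth g := by
  have h : ∀ g : Grp, ∃ s ∈ ({0, {0, 0, 0}} : Finset (Multiset (Fin 7))) ∪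
      Finset.univ.image (fun i => {i}) ∪ Finset.univ.image (fun p : Fin 7 × Fin 7 => {p.1, p.2}),
      weight s = g ∧ s.card = depth g := by
    decide +kernel
  obtain ⟨s, -, hs⟩ := h g
  exact ⟨s, hs⟩

/-- A shortest monomial of degree `g`. -/
noncomputable def word (g : Grp) : Multiset (Fin 7) := (exists_word g).choose

@[simp] theorem weight_word (g : Grp) : weight (word g) = g := (exists_word g).choose_spec.1

@[simp] theorem card_word (g : Grp) : (word g).card = depth g := (exists_word g).choose_spec.2

section Ideal

variable (K : Type) [Field K]

/-- The order whose special fibre is the algebra of interest. -/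
abbrev order : Subalgebra (PowerSeries K) (AddMonoidAlgebra (PowerSeries K) Grp) :=
  filteredOrder K depth depth_zero depth_add_le

/-- The presentation of `order` sending each variable to the corresponding unit. -/
noncomputable def toOrder : MvPolynomial (Fin 7) K →ₐ[K] order K :=
  aeval fun i => homogeneousUnit K depth depth_zero depth_add_le (wt i)

/-- The ideal of the special fibre of `order`. -/
noncomputable def specialIdeal : Ideal (MvPolynomial (Fin 7) K) :=
  (Ideal.span {algebraMap (PowerSeries K) (order K) PowerSeries.X}).comap (toOrder K)

/-- The coefficient of `X ^ k • g` in the image of a polynomial in `order`. -/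
noncomputable def orderCoeff (g : Grp) (k : ℕ) : MvPolynomial (Fin 7) K →ₗ[K] K where
  toFun f := PowerSeries.coeff k ((toOrder K f).1.coeff g)
  map_add' f f' := by simp
  map_smul' c f := by
    rw [map_smul]
    change PowerSeries.coeff k (c • (toOrder K f).1.coeff g) = _
    simp

/-- The coordinates on the quotient by `specialIdeal`. -/
noncomputable abbrev symbol (g : Grp) : MvPolynomial (Fin 7) K →ₗ[K] K :=
  orderCoeff K g (depth g)

/-- The monomial indexed by a multiset of variables. -/
noncomputable def mono (s : Multiset (Fin 7)) : MvPolynomial (Fin 7) K := (s.map X).prod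

variable {K}

@[simp] theorem mono_add (s t : Multiset (Fin 7)) : mono K (s + t) = mono K s * mono K t := by
  simp [mono]

@[simp] theorem mono_cons (i : Fin 7) (s : Multiset (Fin 7)) :
    mono K (i ::ₘ s) = X i * mono K s := by
  simp [mono]

theorem mono_eq_monomial (s : Multiset (Fin 7)) : mono K s = monomial s.toFinsupp 1 := by
  induction s using Multiset.induction_on with
  | empty => simp [mono]
  | cons i s ih =>
    rw [mono_cons, ih, X, monomial_mul, one_mul, ← Multiset.singleton_add, map_add,
      Multiset.toFinsupp_singleton]

theorem coeff_mono (s t : Multiset (Fin 7)) :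
    coeff t.toFinsupp (mono K s) = if s = t then 1 else 0 := by
  rw [mono_eq_monomial, coeff_monomial]
  simp

theorem span_mono : Submodule.span K (Set.range (mono K)) = ⊤ := by
  rw [eq_top_iff]
  intro f _
  induction f using MvPolynomial.induction_on' with
  | monomial n c =>
    have : monomial n c = c • mono K (Finsupp.toMultiset n) := by
      simp [mono_eq_monomial, smul_monomial]
    exact this ▸ Submodule.smul_mem _ _ (Submodule.subset_span ⟨_, rfl⟩)
  | add f g hf hg => exact Submodule.add_mem _ (hf trivial) (hg trivial)

theorem isHomogeneous_mono (s : Multiset (Fin 7)) : (mono K s).IsHomogeneous s.card := by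
  induction s using Multiset.induction_on with
  | empty => simpa [mono] using isHomogeneous_one (Fin 7) K
  | cons i s ih =>
    rw [mono_cons, Multiset.card_cons, add_comm]
    exact (isHomogeneous_X K i).mul ih

theorem toOrder_mono (s : Multiset (Fin 7)) :
    (toOrder K (mono K s)).1 = AddMonoidAlgebra.single (weight s) (PowerSeries.X ^ s.card) := by
  induction s using Multiset.induction_on with
  | empty =>
    rw [mono, Multiset.map_zero, Multiset.prod_zero, map_one, OneMemClass.coe_one,
      AddMonoidAlgebra.one_def, Multiset.card_zero, pow_zero]
    rfl
  | cons i s ih =>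
    rw [mono_cons, map_mul, MulMemClass.coe_mul, ih, weight_cons, toOrder, aeval_X,
      homogeneousUnit, AddMonoidAlgebra.single_mul_single, depth_wt, pow_one, Multiset.card_cons,
      pow_succ']

theorem orderCoeff_mono (g : Grp) (k : ℕ) (s : Multiset (Fin 7)) :
    orderCoeff K g k (mono K s) = if weight s = g ∧ s.card = k then 1 else 0 := by
  change PowerSeries.coeff k ((toOrder K (mono K s)).1.coeff g) = _
  rw [toOrder_mono, AddMonoidAlgebra.coeff_single, Finsupp.single_apply]
  by_cases h : weight s = g
  · simp [h, PowerSeries.coeff_X_pow, eq_comm]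
  · simp [h]

theorem mem_specialIdeal {f : MvPolynomial (Fin 7) K} :
    f ∈ specialIdeal K ↔ ∀ g, symbol K g f = 0 :=
  mem_span_X_iff

theorem symbol_word (g h : Grp) : symbol K g (mono K (word h)) = if h = g then 1 else 0 := by
  rw [orderCoeff_mono, weight_word, card_word]
  exact if_congr (and_iff_left_of_imp fun h => h ▸ rfl) rfl rfl

theorem mono_mem_specialIdeal {s : Multiset (Fin 7)} (h : s.card ≠ depth (weight s)) :
    mono K s ∈ specialIdeal K := by
  refine mem_specialIdeal.2 fun g => ?_
  rw [orderCoeff_mono, if_neg]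
  rintro ⟨rfl, h'⟩
  exact h h'

theorem mono_sub_mono_mem_specialIdeal {s t : Multiset (Fin 7)} (hw : weight s = weight t)
    (hc : s.card = t.card) : mono K s - mono K t ∈ specialIdeal K := by
  refine mem_specialIdeal.2 fun g => ?_
  rw [map_sub, orderCoeff_mono, orderCoeff_mono, hw, hc, sub_self]

theorem symbol_mono_mul {s : Multiset (Fin 7)} {g : Grp}
    (h : depth (g + weight s) = s.card + depth g) (f : MvPolynomial (Fin 7) K) :
    symbol K (g + weight s) (mono K s * f) = symbol K g f := by
  have : symbol K (g + weight s) ∘ₗ LinearMap.mulLeft K (mono K s) = symbol K g := by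
    refine LinearMap.ext_on_range span_mono fun t => ?_
    rw [LinearMap.comp_apply, LinearMap.mulLeft_apply, ← mono_add, orderCoeff_mono,
      orderCoeff_mono, weight_add, Multiset.card_add, h, add_comm g]
    simp only [add_right_inj]
  exact LinearMap.congr_fun this f

theorem symbol_homogeneousComponent (g : Grp) (t : ℕ) (f : MvPolynomial (Fin 7) K) :
    symbol K g (homogeneousComponent t f) = if depth g = t then symbol K g f else 0 := by
  have : symbol K g ∘ₗ homogeneousComponent t = if depth g = t then symbol K g else 0 := by
    refine LinearMap.ext_on_range span_mono fun s => ?_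
    rw [LinearMap.comp_apply, homogeneousComponent_of_mem (isHomogeneous_mono s)]
    by_cases ht : t = s.card
    · rw [if_pos ht]
      split_ifs with hg
      · rfl
      · rw [orderCoeff_mono, if_neg fun h => hg (h.2.symm.trans ht.symm)]
        rfl
    · rw [if_neg ht, map_zero]
      split_ifs with hg
      · rw [orderCoeff_mono, if_neg fun h => ht (h.2.trans hg).symm]
      · rfl
  have := LinearMap.congr_fun this f
  rw [LinearMap.comp_apply] at this
  rw [this]
  split_ifs <;> rfl

theorem homogeneousComponent_mem_specialIdeal {f : MvPolynomial (Fin 7) K}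
    (hf : f ∈ specialIdeal K) (t : ℕ) : homogeneousComponent t f ∈ specialIdeal K := by
  refine mem_specialIdeal.2 fun g => ?_
  rw [symbol_homogeneousComponent, mem_specialIdeal.1 hf, ite_self]

end Ideal

section DualFamily

variable {K : Type*} {R V : Type*} [Field K] [CommRing R] [Algebra K R] [AddCommGroup V]
  [Module K V] {J : Ideal R}

/-- The linear map on a quotient ring induced by a linear map vanishing on the ideal. -/
def quotientLift (e : R →ₗ[K] V) (he : ∀ f ∈ J, e f = 0) : (R ⧸ J) →ₗ[K] V :=
  (J.restrictScalars K).liftQ e he ∘ₗ (Submodule.Quotient.restrictScalarsEquiv K J).symm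

@[simp] theorem quotientLift_mk (e : R →ₗ[K] V) (he : ∀ f ∈ J, e f = 0) (f : R) :
    quotientLift e he (Ideal.Quotient.mk J f) = e f := rfl

variable {T : Type*} {v : T → R} {w : T → R →ₗ[K] K}

theorem linearIndependent_mk_of_dual [Fintype T] [DecidableEq T] (hw : ∀ t, ∀ f ∈ J, w t f = 0)
    (hwv : ∀ t t', w t (v t') = if t' = t then 1 else 0) :
    LinearIndependent K fun t => Ideal.Quotient.mk J (v t) := by
  refine LinearIndependent.of_comp (LinearMap.pi fun t => quotientLift (w t) (hw t)) ?_
  have h : LinearMap.pi (fun t => quotientLift (w t) (hw t)) ∘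
      (fun t => Ideal.Quotient.mk J (v t)) = Pi.basisFun K T := by
    ext t t'
    simp [hwv, Pi.single_apply, eq_comm]
  rw [h]
  exact (Pi.basisFun K T).linearIndependent

theorem span_mk_eq_top (hv : J.restrictScalars K ⊔ Submodule.span K (Set.range v) = ⊤) :
    Submodule.span K (Set.range fun t => Ideal.Quotient.mk J (v t)) = ⊤ := by
  have h := congrArg (Submodule.map (Ideal.Quotient.mkₐ K J).toLinearMap) hv
  have h0 : Submodule.map (Ideal.Quotient.mkₐ K J).toLinearMap (J.restrictScalars K) = ⊥ := by
    rw [eq_bot_iff, Submodule.map_le_iff_le_comap]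
    exact fun f hf => Ideal.Quotient.eq_zero_iff_mem.2 hf
  rw [Submodule.map_sup, h0, bot_sup_eq, Submodule.map_span, ← Set.range_comp, Submodule.map_top,
    LinearMap.range_eq_top.2 (Ideal.Quotient.mkₐ_surjective K J)] at h
  exact h

theorem finrank_quotient_of_dual [Fintype T] [DecidableEq T] (hw : ∀ t, ∀ f ∈ J, w t f = 0)
    (hwv : ∀ t t', w t (v t') = if t' = t then 1 else 0)
    (hv : J.restrictScalars K ⊔ Submodule.span K (Set.range v) = ⊤) :
    Module.finrank K (R ⧸ J) = Fintype.card T :=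
  Module.finrank_eq_card_basis
    (Module.Basis.mk (linearIndependent_mk_of_dual hw hwv) (span_mk_eq_top hv).ge)

theorem finite_quotient_of_dual [Fintype T] [DecidableEq T] (hw : ∀ t, ∀ f ∈ J, w t f = 0)
    (hwv : ∀ t t', w t (v t') = if t' = t then 1 else 0)
    (hv : J.restrictScalars K ⊔ Submodule.span K (Set.range v) = ⊤) :
    Module.Finite K (R ⧸ J) :=
  .of_basis (Module.Basis.mk (linearIndependent_mk_of_dual hw hwv) (span_mk_eq_top hv).ge)

end DualFamily

section Quotient

variable {K : Type} [Field K]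

theorem sub_sum_symbol_smul_mem (f : MvPolynomial (Fin 7) K) :
    f - ∑ g, symbol K g f • mono K (word g) ∈ specialIdeal K := by
  refine mem_specialIdeal.2 fun g => ?_
  simp [symbol_word]

theorem specialIdeal_sup_span :
    (specialIdeal K).restrictScalars K ⊔ Submodule.span K (Set.range fun g => mono K (word g)) =
      ⊤ := by
  rw [eq_top_iff]
  intro f _
  rw [← sub_add_cancel f (∑ g, symbol K g f • mono K (word g))]
  exact Submodule.add_mem_sup (sub_sum_symbol_smul_mem f)
    (Submodule.sum_mem _ fun g _ => Submodule.smul_mem _ _ (Submodule.subset_span ⟨g, rfl⟩))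

theorem symbol_eq_zero_of_mem (g : Grp) : ∀ f ∈ specialIdeal K, symbol K g f = 0 :=
  fun _ hf => mem_specialIdeal.1 hf g

theorem linearIndependent_word :
    LinearIndependent K fun g => Ideal.Quotient.mk (specialIdeal K) (mono K (word g)) :=
  linearIndependent_mk_of_dual symbol_eq_zero_of_mem symbol_word

theorem card_grp : Fintype.card Grp = 16 := by decide

theorem finrank_quotient_specialIdeal :
    Module.finrank K (MvPolynomial (Fin 7) K ⧸ specialIdeal K) = 16 :=
  (finrank_quotient_of_dual symbol_eq_zero_of_mem symbol_word specialIdeal_sup_span).trans card_grp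

instance : Module.Finite K (MvPolynomial (Fin 7) K ⧸ specialIdeal K) :=
  finite_quotient_of_dual symbol_eq_zero_of_mem symbol_word specialIdeal_sup_span

theorem homogeneousSubmodule_eq_span_mono (t : ℕ) :
    homogeneousSubmodule (Fin 7) K t = Submodule.span K (mono K '' {s | s.card = t}) := by
  apply le_antisymm
  · intro f hf
    rw [← homogeneousComponent_of_mem (m := t) hf |>.trans (if_pos rfl)]
    have := Submodule.mem_map_of_mem (f := homogeneousComponent (σ := Fin 7) (R := K) t)
      (show f ∈ Submodule.span K (Set.range (mono K)) from span_mono (K := K) ▸ Submodule.mem_top)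
    rw [Submodule.map_span] at this
    refine Submodule.span_le.2 ?_ this
    rintro _ ⟨_, ⟨s, rfl⟩, rfl⟩
    rw [homogeneousComponent_of_mem (isHomogeneous_mono s)]
    split_ifs with h
    · exact Submodule.subset_span ⟨s, h.symm, rfl⟩
    · exact Submodule.zero_mem _
  · rw [Submodule.span_le]
    rintro _ ⟨s, rfl, rfl⟩
    exact isHomogeneous_mono s

theorem finrank_gradedPiece (t : ℕ) :
    Module.finrank K (gradedPiece K 7 (specialIdeal K) t) =
      Fintype.card {g : Grp // depth g = t} := by
  have : gradedPiece K 7 (specialIdeal K) t = Submodule.span K (Set.range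
      fun g : {g : Grp // depth g = t} => Ideal.Quotient.mk (specialIdeal K) (mono K (word g))) := by
    rw [gradedPiece, homogeneousSubmodule_eq_span_mono, Submodule.map_span]
    apply le_antisymm
    · rw [Submodule.span_le]
      rintro _ ⟨_, ⟨s, rfl, rfl⟩, rfl⟩
      by_cases h : depth (weight s) = s.card
      · refine Submodule.subset_span ⟨⟨weight s, h⟩, ?_⟩
        exact Ideal.Quotient.eq.2 (mono_sub_mono_mem_specialIdeal (by simp) (by simp [h]))
      · have : Ideal.Quotient.mk (specialIdeal K) (mono K s) = 0 :=
          Ideal.Quotient.eq_zero_iff_mem.2 (mono_mem_specialIdeal (Ne.symm h))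
        exact this ▸ Submodule.zero_mem _
    · rw [Submodule.span_le]
      rintro _ ⟨⟨g, rfl⟩, rfl⟩
      exact Submodule.subset_span ⟨_, ⟨word g, card_word g, rfl⟩, rfl⟩
  rw [this]
  exact finrank_span_eq_card
    (linearIndependent_word.comp (fun g : {g : Grp // depth g = t} => g.1) Subtype.val_injective)

theorem socle_specialIdeal : socle K 7 (specialIdeal K) =
    Submodule.span K {Ideal.Quotient.mk (specialIdeal K) (mono K (word top))} := by
  apply le_antisymm
  · intro a ha
    obtain ⟨f, rfl⟩ := Ideal.Quotient.mk_surjective a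
    have hX (i : Fin 7) : mono K {i} * f ∈ specialIdeal K := by
      have := (Submodule.mem_iInf _).1 ha i
      rw [LinearMap.mem_ker, LinearMap.mulRight_apply, ← map_mul,
        Ideal.Quotient.eq_zero_iff_mem] at this
      simpa [mono, mul_comm] using this
    have hg (g : Grp) (hg : g ≠ top) : symbol K g f = 0 := by
      obtain ⟨i, hi⟩ := exists_depth_add g hg
      rw [← symbol_mono_mul (s := {i}) (by simpa [weight] using hi)]
      exact mem_specialIdeal.1 (hX i) _
    refine Submodule.mem_span_singleton.2 ⟨symbol K top f, ?_⟩
    have := sub_sum_symbol_smul_mem f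
    rw [Finset.sum_eq_single top (fun g _ h => by rw [hg g h, zero_smul]) (by simp)] at this
    exact (Ideal.Quotient.eq.2 this).symm
  · rw [Submodule.span_singleton_le_iff_mem, socle, Submodule.mem_iInf]
    intro i
    rw [LinearMap.mem_ker, LinearMap.mulRight_apply, ← map_mul, mul_comm, ← mono_cons,
      Ideal.Quotient.eq_zero_iff_mem]
    refine mono_mem_specialIdeal fun h => ?_
    have := depth_le (weight (i ::ₘ word top))
    rw [← h, Multiset.card_cons, card_word] at this
    exact absurd this (by decide)

theorem finrank_socle : Module.finrank K (socle K 7 (specialIdeal K)) = 1 := by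
  rw [socle_specialIdeal]
  exact finrank_span_singleton (linearIndependent_word.ne_zero top)

theorem isSmoothable_quotient (h2 : (2 : K) ≠ 0) :
    IsSmoothable K (MvPolynomial (Fin 7) K ⧸ specialIdeal K) 16 := by
  refine ⟨order K, inferInstance, inferInstance, inferInstance, inferInstance, inferInstance,
    ?_, ?_, ?_⟩
  · rw [finrank_filteredOrder, Nat.card_eq_fintype_card, card_grp]
  · let q := Ideal.Quotient.mkₐ K
      (Ideal.span {algebraMap (PowerSeries K) (order K) PowerSeries.X})
    have hq : Function.Surjective (q.comp (toOrder K)) := by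
      intro b
      obtain ⟨b, rfl⟩ := Ideal.Quotient.mk_surjective b
      refine ⟨∑ g, PowerSeries.coeff (depth g) (b.1.coeff g) • mono K (word g), ?_⟩
      refine Ideal.Quotient.eq.2 (mem_span_X_iff.2 fun g => ?_)
      have := map_sum (symbol K g)
        (fun g => PowerSeries.coeff (depth g) (b.1.coeff g) • mono K (word g)) Finset.univ
      simp only [map_smul, symbol_word, smul_eq_mul, mul_ite, mul_one, mul_zero,
        Finset.sum_ite_eq', Finset.mem_univ, if_true] at this
      change PowerSeries.coeff (depth g) ((toOrder K _).1.coeff g - b.1.coeff g) = 0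
      rw [map_sub, sub_eq_zero]
      exact this
    have hker : RingHom.ker (q.comp (toOrder K)) = specialIdeal K := by
      ext f
      exact Ideal.Quotient.eq_zero_iff_mem
    exact ⟨((Ideal.quotientEquivAlgOfEq K hker.symm).trans
      (Ideal.quotientKerAlgEquivOfSurjective hq)).symm⟩
  · refine etale_filteredOrder (N := 4) (by decide) ?_
    have : (4 : K) = 2 * 2 := by norm_num
    simpa [this] using h2

end Quotient

section Quartics

/-- Representatives of a basis of the quartics modulo the square of `specialIdeal`. -/
def quarticRep : Option (Fin 7) → Multiset (Fin 7)
  | none => {0, 0, 1, 4}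
  | some 0 => {0, 1, 5, 6}
  | some i => {0, 0, 0, i}

/-- The coordinates of a quartic monomial with respect to `quarticRep`. -/
def quarticCoord (o : Option (Fin 7)) (s : Multiset (Fin 7)) : ℕ :=
  o.elim (if weight s = top then 1 else 0) fun i => if weight s = top + wt i then s.count i else 0

theorem card_quarticRep : ∀ o, (quarticRep o).card = 4 := by decide +kernel

theorem quarticCoord_quarticRep :
    ∀ o o', quarticCoord o (quarticRep o') = if o' = o then 1 else 0 := by
  decide +kernel

/-- A pair `(p, q)` encoding a quadric in `specialIdeal`: the difference of the monomials `p` and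
`q`, or the monomial `p` if `q` is `none`. -/
def IsQuadric (a : Multiset (Fin 7) × Option (Multiset (Fin 7))) : Prop :=
  a.1.card = 2 ∧ a.2.elim (depth (weight a.1) ≠ 2) fun q => q.card = 2 ∧ weight a.1 = weight q

instance : DecidablePred IsQuadric := fun a => by
  rcases a with ⟨p, _ | q⟩ <;> unfold IsQuadric <;> dsimp only [Option.elim] <;> infer_instance

/-- The terms other than the leading one in the product of two quadrics. -/
def lowerTerms (e : (Multiset (Fin 7) × Option (Multiset (Fin 7))) ×
    (Multiset (Fin 7) × Option (Multiset (Fin 7)))) : List (Multiset (Fin 7)) :=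
  (e.2.2.map (e.1.1 + ·)).toList ++ (e.1.2.map (· + e.2.1)).toList ++
    (Option.map₂ (· + ·) e.1.2 e.2.2).toList

/-- Add the leading term of a product of two quadrics to a list containing the other terms. -/
def reduceStep (l : List (Multiset (Fin 7))) (e : (Multiset (Fin 7) × Option (Multiset (Fin 7))) ×
    (Multiset (Fin 7) × Option (Multiset (Fin 7)))) : List (Multiset (Fin 7)) :=
  if IsQuadric e.1 ∧ IsQuadric e.2 ∧ ∀ s ∈ lowerTerms e, s ∈ l then (e.1.1 + e.2.1) :: l else l

/-- The quadratic monomials in `specialIdeal`. -/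
def quadraticMonomials : List (Multiset (Fin 7)) :=
  [{0, 4}, {0, 5}, {0, 6}, {1, 2}, {1, 3}, {1, 4}, {2, 3}, {2, 5}, {3, 6}, {4, 4}, {5, 5}, {6, 6}]

/-- Products of two quadrics. -/
def quadricProducts : List ((Multiset (Fin 7) × Option (Multiset (Fin 7))) ×
    (Multiset (Fin 7) × Option (Multiset (Fin 7)))) :=
  (quadraticMonomials.product quadraticMonomials).map (fun (p, q) => ((p, none), (q, none))) ++
  List.map (fun (p, q, q') => ((p, none), (q, some q')))
  [({0, 4}, {1, 1}, {0, 0}), ({0, 5}, {1, 1}, {0, 0}), ({0, 6}, {1, 1}, {0, 0}),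
   ({1, 4}, {1, 1}, {0, 0}), ({2, 3}, {0, 0}, {1, 1}), ({5, 5}, {1, 1}, {0, 0}),
   ({6, 6}, {1, 1}, {0, 0}), ({0, 4}, {2, 2}, {0, 0}), ({0, 5}, {2, 2}, {0, 0}),
   ({0, 6}, {2, 2}, {0, 0}), ({1, 3}, {0, 0}, {2, 2}), ({1, 4}, {2, 2}, {0, 0}),
   ({2, 3}, {2, 2}, {0, 0}), ({4, 4}, {2, 2}, {0, 0}), ({6, 6}, {2, 2}, {0, 0}),
   ({0, 4}, {3, 3}, {0, 0}), ({0, 5}, {3, 3}, {0, 0}), ({0, 6}, {3, 3}, {0, 0}),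
   ({1, 2}, {0, 0}, {3, 3}), ({1, 3}, {3, 3}, {0, 0}), ({1, 4}, {3, 3}, {0, 0}),
   ({2, 3}, {3, 3}, {0, 0}), ({4, 4}, {3, 3}, {0, 0}), ({5, 5}, {3, 3}, {0, 0}),
   ({1, 3}, {1, 1}, {2, 2}), ({1, 2}, {1, 1}, {3, 3}), ({1, 2}, {2, 2}, {3, 3}),
   ({0, 4}, {5, 6}, {0, 1}), ({0, 5}, {0, 1}, {5, 6}), ({0, 6}, {0, 1}, {5, 6}),
   ({1, 4}, {5, 6}, {0, 1}), ({2, 5}, {5, 6}, {0, 1}), ({3, 6}, {5, 6}, {0, 1}),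
   ({2, 3}, {0, 1}, {5, 6}), ({4, 4}, {5, 6}, {0, 1}), ({0, 4}, {0, 2}, {4, 6}),
   ({0, 5}, {0, 2}, {4, 6}), ({0, 6}, {0, 2}, {4, 6}), ({1, 4}, {4, 6}, {0, 2}),
   ({2, 5}, {4, 6}, {0, 2}), ({3, 6}, {4, 6}, {0, 2}), ({5, 5}, {4, 6}, {0, 2}),
   ({0, 4}, {0, 3}, {4, 5}), ({0, 5}, {0, 3}, {4, 5}), ({0, 6}, {0, 3}, {4, 5}),
   ({1, 4}, {4, 5}, {0, 3}), ({2, 5}, {4, 5}, {0, 3}), ({3, 6}, {4, 5}, {0, 3}),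
   ({6, 6}, {4, 5}, {0, 3}), ({0, 4}, {2, 4}, {1, 5}), ({0, 4}, {3, 4}, {1, 6}),
   ({0, 5}, {1, 5}, {2, 4}), ({0, 5}, {3, 4}, {1, 6}), ({0, 5}, {3, 5}, {2, 6}),
   ({0, 6}, {2, 4}, {1, 5}), ({0, 6}, {1, 6}, {3, 4}), ({0, 6}, {2, 6}, {3, 5}),
   ({1, 2}, {1, 5}, {2, 4}), ({1, 2}, {1, 6}, {3, 4}), ({1, 2}, {2, 6}, {3, 5}),
   ({1, 3}, {1, 5}, {2, 4}), ({1, 3}, {1, 6}, {3, 4}), ({1, 3}, {3, 5}, {2, 6}),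
   ({1, 4}, {1, 5}, {2, 4}), ({1, 4}, {1, 6}, {3, 4}), ({2, 5}, {2, 4}, {1, 5}),
   ({2, 5}, {2, 6}, {3, 5}), ({3, 6}, {3, 4}, {1, 6}), ({3, 6}, {3, 5}, {2, 6}),
   ({2, 3}, {2, 4}, {1, 5}), ({4, 4}, {2, 4}, {1, 5}), ({5, 5}, {1, 5}, {2, 4}),
   ({2, 3}, {3, 4}, {1, 6}), ({4, 4}, {3, 4}, {1, 6}), ({6, 6}, {1, 6}, {3, 4}),
   ({5, 5}, {3, 5}, {2, 6}), ({6, 6}, {2, 6}, {3, 5}), ({2, 5}, {2, 2}, {0, 0}),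
   ({3, 6}, {2, 2}, {0, 0}), ({2, 5}, {3, 3}, {0, 0}), ({3, 6}, {3, 3}, {0, 0}),
   ({5, 5}, {5, 6}, {0, 1}), ({6, 6}, {5, 6}, {0, 1}), ({4, 4}, {4, 6}, {0, 2}),
   ({6, 6}, {4, 6}, {0, 2}), ({4, 4}, {4, 5}, {0, 3}), ({5, 5}, {4, 5}, {0, 3})] ++
  List.map (fun (p, p', q, q') => ((p, some p'), (q, some q')))
  [({0, 1}, {5, 6}, {0, 1}, {5, 6}), ({0, 2}, {4, 6}, {0, 2}, {4, 6}),
   ({0, 3}, {4, 5}, {0, 3}, {4, 5}), ({0, 0}, {1, 1}, {0, 0}, {2, 2}),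
   ({1, 1}, {0, 0}, {1, 1}, {2, 2}), ({1, 1}, {0, 0}, {0, 2}, {4, 6}),
   ({1, 1}, {0, 0}, {0, 3}, {4, 5}), ({1, 1}, {0, 0}, {1, 5}, {2, 4}),
   ({1, 1}, {0, 0}, {1, 6}, {3, 4}), ({2, 2}, {0, 0}, {2, 2}, {1, 1}),
   ({2, 2}, {0, 0}, {0, 1}, {5, 6}), ({2, 2}, {0, 0}, {0, 3}, {4, 5}),
   ({2, 2}, {0, 0}, {2, 4}, {1, 5}), ({2, 2}, {0, 0}, {2, 6}, {3, 5}),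
   ({3, 3}, {0, 0}, {3, 3}, {1, 1}), ({3, 3}, {0, 0}, {0, 1}, {5, 6}),
   ({3, 3}, {0, 0}, {0, 2}, {4, 6}), ({3, 3}, {0, 0}, {3, 4}, {1, 6}),
   ({3, 3}, {0, 0}, {3, 5}, {2, 6}), ({5, 6}, {0, 1}, {1, 5}, {2, 4}),
   ({5, 6}, {0, 1}, {1, 6}, {3, 4}), ({4, 6}, {0, 2}, {2, 4}, {1, 5}),
   ({4, 6}, {0, 2}, {2, 6}, {3, 5}), ({4, 5}, {0, 3}, {3, 4}, {1, 6}),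
   ({4, 5}, {0, 3}, {3, 5}, {2, 6})] ++
  List.map (fun (p, q, q') => ((p, none), (q, some q')))
  [({1, 2}, {5, 6}, {0, 1}), ({1, 3}, {5, 6}, {0, 1}), ({1, 2}, {4, 6}, {0, 2}),
   ({2, 3}, {4, 6}, {0, 2}), ({1, 3}, {4, 5}, {0, 3}), ({2, 3}, {4, 5}, {0, 3})] ++
  List.map (fun (p, p', q, q') => ((p, some p'), (q, some q')))
  [({1, 5}, {2, 4}, {1, 6}, {3, 4}), ({2, 4}, {1, 5}, {2, 6}, {3, 5}),
   ({3, 4}, {1, 6}, {3, 5}, {2, 6}), ({1, 1}, {0, 0}, {0, 1}, {5, 6}),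
   ({2, 2}, {0, 0}, {0, 2}, {4, 6}), ({3, 3}, {0, 0}, {0, 3}, {4, 5})]

/-- Quartic monomials lying in the span of `quarticRep` and the square of `specialIdeal`. -/
def reducedQuartics : List (Multiset (Fin 7)) :=
  quadricProducts.foldl reduceStep ((none :: (List.finRange 7).map some).map quarticRep)

theorem mem_reducedQuartics_of_le : ∀ i j, i ≤ j → ∀ k, j ≤ k → ∀ l, k ≤ l →
    ({i, j, k, l} : Multiset (Fin 7)) ∈ reducedQuartics := by
  decide +kernel

theorem mem_reducedQuartics {s : Multiset (Fin 7)} (hs : s.card = 4) : s ∈ reducedQuartics := by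
  obtain ⟨i, j, k, l, h⟩ : ∃ i j k l, s.sort (· ≤ ·) = [i, j, k, l] := by
    apply List.length_eq_four.1
    rw [Multiset.length_sort, hs]
  have hsort := s.pairwise_sort (· ≤ ·)
  rw [← s.sort_eq (· ≤ ·), h]
  rw [h] at hsort
  simp only [List.pairwise_cons, List.mem_cons] at hsort
  exact mem_reducedQuartics_of_le i j (hsort.1 j (by simp)) k (hsort.2.1 k (by simp)) l
    (hsort.2.2.1 l (by simp))

theorem exists_quarticCoord_erase_eq_zero : ∀ o i,
    ∃ s ∈ ([{0, 1, 2, 2}, {0, 1, 1, 2}, {0, 1, 1, 3}, {1, 4, 5, 6}, {2, 4, 5, 6}, {3, 4, 5, 6},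
      {0, 4, 5, 6}, {0, 1, 5, 6}, {0, 2, 4, 6}] : List (Multiset (Fin 7))), s.card = 4 ∧
      (∀ o', quarticCoord o' s = quarticCoord o' (quarticRep o)) ∧ ∃ j, j ∈ s ∧
        ∀ o', quarticCoord o' ((i ::ₘ s).erase j) = 0 := by
  decide +kernel

end Quartics

section SquareQuotient

variable {K : Type} [Field K]

variable (K) in
/-- The coordinates on quartics dual to `quarticRep`, vanishing on the square of `specialIdeal`. -/
noncomputable def quarticDual : Option (Fin 7) → MvPolynomial (Fin 7) K →ₗ[K] K
  | none => orderCoeff K top 4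
  | some i => symbol K top ∘ₗ (pderiv i).toLinearMap

theorem depth_top : depth top = 3 := by decide

theorem pderiv_mono (i : Fin 7) (s : Multiset (Fin 7)) :
    pderiv i (mono K s) = (s.count i : K) • mono K (s.erase i) := by
  have h : s.toFinsupp - Finsupp.single i 1 = (s.erase i).toFinsupp := by
    ext j
    rw [Finsupp.tsub_apply, Finsupp.single_apply, Multiset.toFinsupp_apply,
      Multiset.toFinsupp_apply]
    split_ifs with h
    · rw [h, Multiset.count_erase_self]
    · rw [Multiset.count_erase_of_ne (Ne.symm h), Nat.sub_zero]
  rw [mono_eq_monomial, pderiv_monomial, mono_eq_monomial, smul_monomial, one_mul, smul_eq_mul,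
    mul_one, Multiset.toFinsupp_apply, h]

theorem quarticDual_mono (o : Option (Fin 7)) (s : Multiset (Fin 7)) :
    quarticDual K o (mono K s) = if s.card = 4 then (quarticCoord o s : K) else 0 := by
  cases o with
  | none =>
    change orderCoeff K top 4 (mono K s) = _
    rw [orderCoeff_mono]
    by_cases h : s.card = 4 <;> simp [h, quarticCoord]
  | some i =>
    change symbol K top (pderiv i (mono K s)) = _
    rw [pderiv_mono, map_smul, orderCoeff_mono, depth_top]
    by_cases hi : i ∈ s
    · obtain ⟨t, rfl⟩ := Multiset.exists_cons_of_mem hi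
      simp only [Multiset.erase_cons_head, Multiset.card_cons, Nat.reduceEqDiff, quarticCoord,
        Option.elim, weight_cons, add_comm top, add_right_inj, smul_eq_mul, mul_ite, mul_one,
        mul_zero, ite_and, Nat.cast_ite, Nat.cast_zero]
      split_ifs <;> rfl
    · have : quarticCoord (some i) s = 0 := by simp [quarticCoord, Multiset.count_eq_zero.2 hi]
      simp [Multiset.count_eq_zero.2 hi, this]

theorem quarticDual_quarticRep (o o' : Option (Fin 7)) :
    quarticDual K o (mono K (quarticRep o')) = if o' = o then 1 else 0 := by
  rw [quarticDual_mono, if_pos (card_quarticRep o'), quarticCoord_quarticRep]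
  split_ifs <;> simp

theorem quarticDual_eq_zero_of_mem (o : Option (Fin 7)) :
    ∀ f ∈ specialIdeal K ^ 2, quarticDual K o f = 0 := by
  intro f hf
  rw [pow_two] at hf
  induction hf using Submodule.mul_induction_on' with
  | add f _ g _ hf hg => rw [map_add, hf, hg, add_zero]
  | mem_mul_mem f hf g hg =>
    cases o with
    | none =>
      obtain ⟨a, ha⟩ := Ideal.mem_span_singleton'.1 hf
      obtain ⟨b, hb⟩ := Ideal.mem_span_singleton'.1 hg
      change PowerSeries.coeff 4 ((toOrder K (f * g)).1.coeff top) = 0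
      have h : toOrder K (f * g) = (PowerSeries.X ^ 2 : PowerSeries K) • (a * b) := by
        have hf' : a * _ = toOrder K f := ha
        have hg' : b * _ = toOrder K g := hb
        rw [map_mul, ← hf', ← hg', Algebra.smul_def, map_pow]
        ring
      obtain ⟨r, hr⟩ := mem_filteredOrder.1 (a * b).2 top
      have h' : (toOrder K (f * g)).1.coeff top = PowerSeries.X ^ 5 * r := by
        rw [h]
        change PowerSeries.X ^ 2 * (a * b).1.coeff top = _
        rw [hr, depth_top]
        ring
      rw [h']
      exact PowerSeries.X_pow_dvd_iff.1 (dvd_mul_right _ r) 4 (by norm_num)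
    | some i =>
      change symbol K top (pderiv i (f * g)) = 0
      rw [Derivation.leibniz, map_add, smul_eq_mul, smul_eq_mul,
        symbol_eq_zero_of_mem top _ (Ideal.mul_mem_right _ _ hf),
        symbol_eq_zero_of_mem top _ (Ideal.mul_mem_right _ _ hg), add_zero]

/-- The polynomial encoded by a pair as in `IsQuadric`. -/
noncomputable def quadric (K : Type) [Field K]
    (a : Multiset (Fin 7) × Option (Multiset (Fin 7))) : MvPolynomial (Fin 7) K :=
  mono K a.1 - a.2.elim 0 (mono K)

theorem quadric_mem_specialIdeal {a : Multiset (Fin 7) × Option (Multiset (Fin 7))}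
    (ha : IsQuadric a) : quadric K a ∈ specialIdeal K := by
  obtain ⟨p, _ | q⟩ := a
  · rw [quadric, Option.elim, sub_zero]
    exact mono_mem_specialIdeal fun h => ha.2 (h.symm.trans ha.1)
  · exact mono_sub_mono_mem_specialIdeal ha.2.2 (ha.1.trans ha.2.1.symm)

theorem mono_mem_of_mem_reduceStep {W : Submodule K (MvPolynomial (Fin 7) K)}
    (hW : (specialIdeal K ^ 2).restrictScalars K ≤ W) {l : List (Multiset (Fin 7))}
    (hl : ∀ s ∈ l, mono K s ∈ W) (e : (Multiset (Fin 7) × Option (Multiset (Fin 7))) ×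
      (Multiset (Fin 7) × Option (Multiset (Fin 7)))) :
    ∀ s ∈ reduceStep l e, mono K s ∈ W := by
  intro s hs
  rw [reduceStep] at hs
  split_ifs at hs with h
  · rcases List.mem_cons.1 hs with rfl | hs
    · obtain ⟨h₁, h₂, h⟩ := h
      have hmul : quadric K e.1 * quadric K e.2 ∈ W :=
        hW (pow_two (specialIdeal K) ▸
          Ideal.mul_mem_mul (quadric_mem_specialIdeal h₁) (quadric_mem_specialIdeal h₂))
      replace h : ∀ s ∈ lowerTerms e, mono K s ∈ W := fun s hs => hl s (h s hs)
      obtain ⟨⟨p, _ | p'⟩, ⟨q, _ | q'⟩⟩ := e <;>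
      simp only [lowerTerms, quadric, Option.elim, Option.map, Option.map₂, Option.bind,
        Option.toList, List.append_nil, List.nil_append, List.cons_append, List.mem_cons,
        List.not_mem_nil, or_false, forall_eq, forall_eq_or_imp, IsEmpty.forall_iff, implies_true,
        mono_add, sub_zero] at h hmul ⊢
      · exact hmul
      · convert W.add_mem hmul h using 1
        ring
      · convert W.add_mem hmul h using 1
        ring
      · convert W.sub_mem (W.add_mem (W.add_mem hmul h.1) h.2.1) h.2.2 using 1
        ring
    · exact hl s hs
  · exact hl s hs

theorem mono_mem_of_mem_foldl_reduceStep {W : Submodule K (MvPolynomial (Fin 7) K)}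
    (hW : (specialIdeal K ^ 2).restrictScalars K ≤ W)
    (es : List ((Multiset (Fin 7) × Option (Multiset (Fin 7))) ×
      (Multiset (Fin 7) × Option (Multiset (Fin 7))))) :
    ∀ l : List (Multiset (Fin 7)), (∀ s ∈ l, mono K s ∈ W) →
      ∀ s ∈ es.foldl reduceStep l, mono K s ∈ W := by
  induction es with
  | nil => exact fun _ hl => hl
  | cons e es ih => exact fun l hl => ih _ (mono_mem_of_mem_reduceStep hW hl e)

theorem mono_mem_sup_span_quarticRep {s : Multiset (Fin 7)} (hs : s.card = 4) :
    mono K s ∈ (specialIdeal K ^ 2).restrictScalars K ⊔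
      Submodule.span K (Set.range fun o => mono K (quarticRep o)) := by
  refine mono_mem_of_mem_foldl_reduceStep le_sup_left _ _ ?_ s (mem_reducedQuartics hs)
  intro t ht
  obtain ⟨o, -, rfl⟩ := List.mem_map.1 ht
  exact Submodule.mem_sup_right (Submodule.subset_span ⟨o, rfl⟩)

theorem mono_sub_sum_quarticRep_mem {s : Multiset (Fin 7)} (hs : s.card = 4) :
    mono K s - ∑ o, (quarticCoord o s : K) • mono K (quarticRep o) ∈ specialIdeal K ^ 2 := by
  obtain ⟨f, hf, g, hg, hfg⟩ := Submodule.mem_sup.1 (mono_mem_sup_span_quarticRep (K := K) hs)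
  obtain ⟨c, rfl⟩ := (Submodule.mem_span_range_iff_exists_fun K).1 hg
  have hc (o : Option (Fin 7)) : (quarticCoord o s : K) = c o := by
    have := congrArg (quarticDual K o) hfg
    rw [map_add, quarticDual_eq_zero_of_mem o f hf, zero_add, map_sum, quarticDual_mono,
      if_pos hs] at this
    simpa [quarticDual_quarticRep] using this.symm
  simp only [hc]
  rwa [← hfg, add_sub_cancel_right]

theorem mono_sub_mono_mem_sq {s t : Multiset (Fin 7)} (hs : s.card = 4) (ht : t.card = 4)
    (h : ∀ o, quarticCoord o s = quarticCoord o t) :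
    mono K s - mono K t ∈ specialIdeal K ^ 2 := by
  have := Ideal.sub_mem _ (mono_sub_sum_quarticRep_mem (K := K) hs)
    (mono_sub_sum_quarticRep_mem (K := K) ht)
  simpa only [h, sub_sub_sub_cancel_right] using this

theorem mono_mem_sq {s : Multiset (Fin 7)} (hs : s.card = 4) (h : ∀ o, quarticCoord o s = 0) :
    mono K s ∈ specialIdeal K ^ 2 := by
  simpa [h] using mono_sub_sum_quarticRep_mem (K := K) hs

theorem X_mul_quarticRep_mem_sq (o : Option (Fin 7)) (i : Fin 7) :
    X i * mono K (quarticRep o) ∈ specialIdeal K ^ 2 := by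
  obtain ⟨s, -, hs, hso, j, hj, hij⟩ := exists_quarticCoord_erase_eq_zero o i
  have h₁ := Ideal.mul_mem_left _ (X i)
    (mono_sub_mono_mem_sq (K := K) hs (card_quarticRep o) hso)
  have hj' : j ∈ i ::ₘ s := Multiset.mem_cons_of_mem hj
  have h₂ : mono K (i ::ₘ s) ∈ specialIdeal K ^ 2 := by
    rw [← Multiset.cons_erase hj', mono_cons]
    refine Ideal.mul_mem_left _ _ (mono_mem_sq ?_ hij)
    rw [Multiset.card_erase_of_mem hj', Multiset.card_cons, hs]
    rfl
  rw [mono_cons] at h₂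
  simpa [mul_sub] using Ideal.sub_mem _ h₂ h₁

theorem mono_mem_sq_of_five_le (k : ℕ) :
    ∀ s : Multiset (Fin 7), s.card = 5 + k → mono K s ∈ specialIdeal K ^ 2 := by
  induction k with
  | zero =>
    intro s hs
    obtain ⟨i, s, rfl⟩ := Multiset.card_pos_iff_exists_mem.1 (by omega : 0 < s.card) |>.imp
      fun i hi => Multiset.exists_cons_of_mem hi
    have hs' : s.card = 4 := by simpa using hs
    have h := Ideal.mul_mem_left _ (X i) (mono_sub_sum_quarticRep_mem (K := K) hs')
    rw [mul_sub, ← mono_cons, Finset.mul_sum] at h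
    refine (Submodule.sub_mem_iff_left _ (Ideal.sum_mem _ fun o _ => ?_)).1 h
    rw [mul_smul_comm]
    exact Submodule.smul_of_tower_mem _ _ (X_mul_quarticRep_mem_sq o i)
  | succ k ih =>
    intro s hs
    obtain ⟨i, s, rfl⟩ := Multiset.card_pos_iff_exists_mem.1 (by omega : 0 < s.card) |>.imp
      fun i hi => Multiset.exists_cons_of_mem hi
    rw [mono_cons]
    exact Ideal.mul_mem_left _ _ (ih s (by simpa [← add_assoc] using hs))

/-- The index set for a monomial basis of the quotient by the square of `specialIdeal`. -/
abbrev SqIndex := (Σ k : Fin 4, Sym (Fin 7) k) ⊕ Option (Fin 7)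

/-- The monomials forming a basis of the quotient by the square of `specialIdeal`. -/
def sqRep : SqIndex → Multiset (Fin 7) := Sum.elim (fun x => x.2.1) quarticRep

variable (K) in
/-- The dual family to `sqRep`. -/
noncomputable def sqDual : SqIndex → MvPolynomial (Fin 7) K →ₗ[K] K :=
  Sum.elim (fun x => lcoeff K x.2.1.toFinsupp) (quarticDual K)

theorem sqDual_sqRep (t t' : SqIndex) :
    sqDual K t (mono K (sqRep t')) = if t' = t then 1 else 0 := by
  rcases t with ⟨k, s, hs⟩ | o
  · change coeff s.toFinsupp _ = _
    rw [coeff_mono]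
    refine if_congr ?_ rfl rfl
    rcases t' with ⟨k', s', hs'⟩ | o'
    · constructor
      · rintro rfl
        obtain rfl : k = k' := Fin.ext (hs.symm.trans hs')
        rfl
      · intro h
        cases h
        rfl
    · simp only [reduceCtorEq, iff_false]
      rintro rfl
      have := card_quarticRep o'
      have := k.2
      simp only [sqRep, Sum.elim_inr] at hs
      omega
  · change quarticDual K o _ = _
    rcases t' with ⟨k', s', hs'⟩ | o'
    · rw [quarticDual_mono, if_neg, if_neg Sum.inl_ne_inr]
      have := k'.2
      simp only [sqRep, Sum.elim_inl]
      omega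
    · simp [sqRep, quarticDual_quarticRep]

theorem degree_toFinsupp (s : Multiset (Fin 7)) : s.toFinsupp.degree = s.card := by
  conv_rhs => rw [← Multiset.toFinsupp_toMultiset s, Finsupp.card_toMultiset]
  rfl

theorem specialIdeal_le_idealOfVars_sq : specialIdeal K ≤ idealOfVars (Fin 7) K ^ 2 := by
  intro f hf
  rw [mem_pow_idealOfVars_iff']
  intro n hn
  obtain ⟨t, rfl⟩ := Multiset.toFinsupp.surjective n
  have ht : t.card < 2 := degree_toFinsupp t ▸ hn
  have h : lcoeff K t.toFinsupp = symbol K (weight t) := by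
    refine LinearMap.ext_on_range span_mono fun s => ?_
    rw [orderCoeff_mono]
    refine (coeff_mono s t).trans (if_congr ?_ rfl rfl)
    have ht' : depth (weight t) = t.card := by
      rcases Nat.lt_succ_iff_lt_or_eq.1 ht with ht | ht
      · rw [Multiset.card_eq_zero.1 (Nat.lt_one_iff.1 ht)]
        rfl
      · obtain ⟨i, rfl⟩ := Multiset.card_eq_one.1 ht
        simp [weight, depth_wt]
    rw [ht']
    refine ⟨by rintro rfl; exact ⟨rfl, rfl⟩, fun ⟨hw, hc⟩ => ?_⟩
    rcases Nat.lt_succ_iff_lt_or_eq.1 ht with ht | ht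
    · rw [Nat.lt_one_iff] at ht
      rw [Multiset.card_eq_zero.1 ht, Multiset.card_eq_zero.1 (hc.trans ht)]
    · obtain ⟨i, rfl⟩ := Multiset.card_eq_one.1 ht
      obtain ⟨j, rfl⟩ := Multiset.card_eq_one.1 (hc.trans ht)
      rw [wt_injective (by simpa [weight] using hw : wt j = wt i)]
  exact (LinearMap.congr_fun h f).trans (symbol_eq_zero_of_mem _ f hf)

theorem sqDual_eq_zero_of_mem (t : SqIndex) : ∀ f ∈ specialIdeal K ^ 2, sqDual K t f = 0 := by
  intro f hf
  rcases t with ⟨k, s, hs⟩ | o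
  · have hf' : f ∈ idealOfVars (Fin 7) K ^ (2 * 2) := by
      rw [pow_mul]
      exact Ideal.pow_right_mono specialIdeal_le_idealOfVars_sq 2 hf
    exact (mem_pow_idealOfVars_iff' _ _).1 hf' s.toFinsupp
      (by rw [degree_toFinsupp, hs]; exact k.2)
  · exact quarticDual_eq_zero_of_mem o f hf

theorem specialIdeal_sq_sup_span :
    (specialIdeal K ^ 2).restrictScalars K ⊔
      Submodule.span K (Set.range fun t => mono K (sqRep t)) = ⊤ := by
  rw [eq_top_iff, ← span_mono, Submodule.span_le]
  rintro _ ⟨s, rfl⟩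
  rcases lt_trichotomy s.card 4 with hs | hs | hs
  · exact Submodule.mem_sup_right (Submodule.subset_span ⟨Sum.inl ⟨⟨s.card, hs⟩, s, rfl⟩, rfl⟩)
  · have h : (Set.range fun o => mono K (quarticRep o)) ⊆ Set.range fun t => mono K (sqRep t) := by
      rintro _ ⟨o, rfl⟩
      exact ⟨Sum.inr o, rfl⟩
    have hle := sup_le_sup_left (Submodule.span_mono (R := K) h)
      ((specialIdeal K ^ 2).restrictScalars K)
    exact hle (mono_mem_sup_span_quarticRep hs)
  · obtain ⟨k, hk⟩ := Nat.exists_eq_add_of_lt hs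
    exact Submodule.mem_sup_left (mono_mem_sq_of_five_le k s (by omega))

theorem card_sqIndex : Fintype.card SqIndex = 128 := by
  simp only [Fintype.card_sum, Fintype.card_sigma, Sym.card_sym_eq_choose, Fintype.card_fin,
    Fintype.card_option, Fin.sum_univ_four]
  decide

theorem finrank_quotient_sq :
    Module.finrank K (MvPolynomial (Fin 7) K ⧸ specialIdeal K ^ 2) = 128 :=
  (finrank_quotient_of_dual sqDual_eq_zero_of_mem sqDual_sqRep specialIdeal_sq_sup_span).trans
    card_sqIndex

instance : Module.Finite K (MvPolynomial (Fin 7) K ⧸ specialIdeal K ^ 2) :=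
  finite_quotient_of_dual sqDual_eq_zero_of_mem sqDual_sqRep specialIdeal_sq_sup_span

theorem finrank_hom_specialIdeal :
    Module.finrank K (specialIdeal K →ₗ[MvPolynomial (Fin 7) K]
      MvPolynomial (Fin 7) K ⧸ specialIdeal K) = 112 := by
  have h := finrank_hom_quotient_add K (specialIdeal K)
    (quotientLift (symbol K top) (symbol_eq_zero_of_mem top)) fun a ha => by
      obtain ⟨f, rfl⟩ := Ideal.Quotient.mk_surjective a
      refine Ideal.Quotient.eq_zero_iff_mem.2 (mem_specialIdeal.2 fun g => ?_)
      have hf := ha (Ideal.Quotient.mk _ (mono K (word (top - g))))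
      rw [← map_mul, quotientLift_mk] at hf
      have hmul := symbol_mono_mul (K := K) (s := word (top - g)) (g := g)
        (by simp [depth_top_sub, depth_top]) f
      rwa [weight_word, add_sub_cancel, hf, eq_comm] at hmul
  rw [finrank_quotient_specialIdeal, finrank_quotient_sq] at h
  omega

end SquareQuotient

end SmoothPoint

/-- Over an algebraically closed field `K` with `char K ≠ 2, 3`, there is a homogeneous ideal
`I ⊆ K[x₁,…,x₇]` whose quotient is graded Gorenstein with Hilbert function `(1,7,7,1)`,
is smoothable (with `d = 16`), and such that `Hom_R(I, R/I)` has `K`-dimension `112`. -/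
theorem exists_smooth_gorenstein_point_1771 (K : Type) [Field K] [IsAlgClosed K]
    (hchar2 : ringChar K ≠ 2) (hchar3 : ringChar K ≠ 3) :
    ∃ I : Ideal (MvPolynomial (Fin 7) K),
      (∀ f ∈ I, ∀ d : ℕ, MvPolynomial.homogeneousComponent d f ∈ I) ∧
      Module.finrank K (gradedPiece K 7 I 0) = 1 ∧
      Module.finrank K (gradedPiece K 7 I 1) = 7 ∧
      Module.finrank K (gradedPiece K 7 I 2) = 7 ∧
      Module.finrank K (gradedPiece K 7 I 3) = 1 ∧
      (∀ t : ℕ, 4 ≤ t → Module.finrank K (gradedPiece K 7 I t) = 0) ∧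
      Module.finrank K (socle K 7 I) = 1 ∧
      IsSmoothable K (MvPolynomial (Fin 7) K ⧸ I) 16 ∧
      Module.finrank K (I →ₗ[MvPolynomial (Fin 7) K] (MvPolynomial (Fin 7) K ⧸ I)) = 112 := by
  have h2 : (2 : K) ≠ 0 := Ring.two_ne_zero hchar2
  refine ⟨SmoothPoint.specialIdeal K,
    fun f hf d => SmoothPoint.homogeneousComponent_mem_specialIdeal hf d, ?_, ?_, ?_, ?_, ?_,
    SmoothPoint.finrank_socle, SmoothPoint.isSmoothable_quotient h2,
    SmoothPoint.finrank_hom_specialIdeal⟩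
  · rw [SmoothPoint.finrank_gradedPiece]
    decide
  · rw [SmoothPoint.finrank_gradedPiece]
    decide
  · rw [SmoothPoint.finrank_gradedPiece]
    decide
  · rw [SmoothPoint.finrank_gradedPiece]
    decide
  · intro t ht
    rw [SmoothPoint.finrank_gradedPiece, Fintype.card_eq_zero_iff]
    exact ⟨fun g => by have := SmoothPoint.depth_le g.1; have := g.2; omega⟩
end

section
/- Let K be an algebraically closed field of characteristic 0 and R = K[x1,…,x5]. There exists a homogeneous ideal I ⊆ R such that: (i) the graded K-algebra A = R/I has Hilbert function (1,5,5,1) and is Gorenstein; (ii) A is smoothable (with d = 12); and (iii) the K-vector space of R-module homomorphisms Hom_R(I, R/I) has dimension 60 over K. -/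
namespace KleinCubic

open MvPolynomial

section Frame

variable (K : Type) [Field K]

/-- The monomial with exponent vector `v`. -/
noncomputable def mono (v : Fin 5 → ℕ) : MvPolynomial (Fin 5) K :=
  monomial (Finsupp.equivFunOnFinite.symm v) 1

theorem mono_add (v w : Fin 5 → ℕ) : mono K (v + w) = mono K v * mono K w := by
  have h : Finsupp.equivFunOnFinite.symm (v + w) =
      Finsupp.equivFunOnFinite.symm v + Finsupp.equivFunOnFinite.symm w := by
    ext i; simp
  simp [mono, monomial_mul, h]

theorem mono_single (i : Fin 5) : mono K (Pi.single i 1) = X i := by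
  simp [mono, X]

theorem mono_eq_prod (v : Fin 5 → ℕ) : mono K v = ∏ i, X i ^ v i := by
  rw [mono, monomial_eq, Finsupp.prod_fintype _ _ (fun i => pow_zero _)]
  simp

theorem isHomogeneous_mono (v : Fin 5 → ℕ) : (mono K v).IsHomogeneous (∑ i, v i) := by
  apply isHomogeneous_monomial
  simp [Finsupp.degree_eq_sum]

/-- The linear functional on polynomials taking the value `c v` on the monomial with
exponent vector `v`. -/
noncomputable def functional (c : (Fin 5 → ℕ) → ℤ) : MvPolynomial (Fin 5) K →ₗ[K] K :=
  (basisMonomials (Fin 5) K).constr K fun m => (c m : K)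

theorem functional_mono (c : (Fin 5 → ℕ) → ℤ) (v : Fin 5 → ℕ) :
    functional K c (mono K v) = c v := by
  have := (basisMonomials (Fin 5) K).constr_basis K (fun m => (c m : K))
    (Finsupp.equivFunOnFinite.symm v)
  simpa [functional, mono] using this

variable {K}

theorem linearMap_ext_mono {V : Type*} [AddCommMonoid V] [Module K V]
    {f g : MvPolynomial (Fin 5) K →ₗ[K] V} (h : ∀ v, f (mono K v) = g (mono K v)) : f = g := by
  refine (basisMonomials (Fin 5) K).ext fun m => ?_
  have := h m
  simpa [mono] using this

theorem functional_eq_zero_of_mem_span {ι : Type*} [Fintype ι] (c : (Fin 5 → ℕ) → ℤ)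
    (g : ι → MvPolynomial (Fin 5) K) (h : ∀ u n, functional K c (mono K u * g n) = 0)
    {f : MvPolynomial (Fin 5) K} (hf : f ∈ Ideal.span (Set.range g)) :
    functional K c f = 0 := by
  obtain ⟨r, rfl⟩ := Ideal.mem_span_range_iff_exists_fun.1 hf
  rw [map_sum]
  refine Finset.sum_eq_zero fun n _ => ?_
  have : (functional K c) ∘ₗ (LinearMap.mulRight K (g n)) = 0 :=
    linearMap_ext_mono fun v => by simpa using h v n
  exact LinearMap.congr_fun this (r n)

theorem mk_mem_of_closed (J : Ideal (MvPolynomial (Fin 5) K))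
    (S : Submodule K (MvPolynomial (Fin 5) K ⧸ J)) (h1 : 1 ∈ S)
    (hX : ∀ i, ∀ x ∈ S, Ideal.Quotient.mk J (X i) * x ∈ S) : S = ⊤ := by
  rw [eq_top_iff]
  rintro x -
  obtain ⟨f, rfl⟩ := Ideal.Quotient.mk_surjective x
  induction f using MvPolynomial.induction_on with
  | C a =>
    rw [C_eq_smul_one]
    exact S.smul_mem a h1
  | add p q hp hq => rw [map_add]; exact S.add_mem hp hq
  | mul_X p i hp => rw [map_mul, mul_comm]; exact hX i _ hp

variable {ι : Type*} [Fintype ι] [DecidableEq ι] {J : Ideal (MvPolynomial (Fin 5) K)}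
  {rep : ι → Fin 5 → ℕ} {c : ι → (Fin 5 → ℕ) → ℤ}

theorem exists_basis_of_dual (h1 : ∀ i j, c i (rep j) = if i = j then 1 else 0)
    (h2 : ∀ i, ∀ f ∈ J, functional K (c i) f = 0)
    (h3 : Submodule.span K (Set.range fun i => Ideal.Quotient.mk J (mono K (rep i))) = ⊤) :
    ∃ b : Module.Basis ι K (MvPolynomial (Fin 5) K ⧸ J),
      (∀ i, b i = Ideal.Quotient.mk J (mono K (rep i))) ∧
      ∀ i f, b.repr (Ideal.Quotient.mk J f) i = functional K (c i) f := by
  let φ (i : ι) : (MvPolynomial (Fin 5) K ⧸ J) →ₗ[K] K :=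
    (J.restrictScalars K).liftQ (functional K (c i)) fun f hf => h2 i f hf
  have hφ (i : ι) (f) : φ i (Ideal.Quotient.mk J f) = functional K (c i) f := rfl
  have hδ (i j : ι) : φ i (Ideal.Quotient.mk J (mono K (rep j))) = if i = j then 1 else 0 := by
    rw [hφ, functional_mono, h1]; split_ifs <;> simp
  have hli : LinearIndependent K fun i => Ideal.Quotient.mk J (mono K (rep i)) := by
    rw [Fintype.linearIndependent_iff]
    intro a ha i
    simpa [hδ] using congrArg (φ i) ha
  refine ⟨.mk hli h3.ge, fun i => by simp, fun i f => ?_⟩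
  rw [← hφ]
  change ((Module.Basis.mk hli h3.ge).coord i) _ = _
  congr 1
  refine (Module.Basis.mk hli h3.ge).ext fun j => ?_
  rw [Module.Basis.mk_apply, hδ, ← Module.Basis.mk_apply hli h3.ge j, Module.Basis.coord_apply,
    Module.Basis.repr_self, Finsupp.single_apply]
  simp [eq_comm]

end Frame

/-- The `ℤ/11`-weight `(1, 9, 4, 3, 5)` of a monomial, as a natural number. -/
def weight (v : Fin 5 → ℕ) : ℕ := v 0 + 9 * v 1 + 4 * v 2 + 3 * v 3 + 5 * v 4

/-- The degree of a monomial. -/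
def deg (v : Fin 5 → ℕ) : ℕ := v 0 + v 1 + v 2 + v 3 + v 4

/-- The exponent of the normal form of `x ^ n` modulo `x ^ 12 = x`. -/
def reduced (n : ℕ) : ℕ := if n = 0 then 0 else (n - 1) % 11 + 1

/-- The degree of the `k`-th basis monomial of the apolar algebra. -/
def level : Fin 12 → ℕ := ![0, 1, 2, 1, 1, 1, 2, 2, 2, 1, 2, 3]

/-- The `k`-th basis monomial of the apolar algebra; its weight reduces to `k`. -/
def basisExp : Fin 12 → Fin 5 → ℕ :=
  ![![0, 0, 0, 0, 0], ![1, 0, 0, 0, 0], ![2, 0, 0, 0, 0], ![0, 0, 0, 1, 0], ![0, 0, 1, 0, 0],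
    ![0, 0, 0, 0, 1], ![0, 0, 0, 2, 0], ![0, 2, 0, 0, 0], ![0, 0, 2, 0, 0], ![0, 1, 0, 0, 0],
    ![0, 0, 0, 0, 2], ![2, 1, 0, 0, 0]]

/-- The functional dual to the `k`-th basis monomial, on monomials. -/
def coordFun (k : Fin 12) (v : Fin 5 → ℕ) : ℤ :=
  if deg v = level k ∧ reduced (weight v) = k then 1 else 0

theorem coordFun_basisExp : ∀ i j, coordFun i (basisExp j) = if i = j then 1 else 0 := by
  decide

/-- The first exponent vector of each quadric generator. -/
def lead : Fin 5 ⊕ Fin 5 → Fin 5 → ℕ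
  | .inl i => Pi.single i 1 + Pi.single (i + 2) 1
  | .inr i => Pi.single i 1 + Pi.single i 1

/-- The second exponent vector of each quadric generator. -/
def tail : Fin 5 ⊕ Fin 5 → Fin 5 → ℕ
  | .inl i => Pi.single i 1 + Pi.single (i + 2) 1
  | .inr i => Pi.single (i + 1) 1 + Pi.single (i + 2) 1

/-- The coefficient of the second monomial in minus each quadric generator. -/
def tailCoeff : Fin 5 ⊕ Fin 5 → ℤ
  | .inl _ => 0
  | .inr _ => 1

theorem deg_add (u v : Fin 5 → ℕ) : deg (u + v) = deg u + deg v := by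
  simp [deg]; ring

theorem weight_add (u v : Fin 5 → ℕ) : weight (u + v) = weight u + weight v := by
  simp [weight]; ring

theorem eq_zero_of_deg {u : Fin 5 → ℕ} (h : deg u = 0) : u = 0 := by
  ext i
  simp only [deg] at h
  fin_cases i <;> simp <;> omega

theorem exists_add_single {u : Fin 5 → ℕ} {n : ℕ} (h : deg u = n + 1) :
    ∃ v j, deg v = n ∧ u = v + Pi.single j 1 := by
  obtain ⟨j, hj⟩ : ∃ j, u j ≠ 0 := by
    by_contra! H
    simp [deg, H] at h
  have hu : u = (u - Pi.single j 1) + Pi.single j 1 := by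
    ext i
    rcases eq_or_ne i j with rfl | hij
    · simp; omega
    · simp [Pi.single_eq_of_ne hij]
  refine ⟨u - Pi.single j 1, j, ?_, hu⟩
  have h1 : deg (Pi.single j 1) = 1 := by clear hu hj; revert j; decide
  rw [hu, deg_add, h1] at h
  omega

theorem deg_lead (n : Fin 5 ⊕ Fin 5) : deg (lead n) = 2 := by revert n; decide

theorem deg_tail (n : Fin 5 ⊕ Fin 5) : deg (tail n) = 2 := by revert n; decide

theorem coordFun_relation (k : Fin 12) (u : Fin 5 → ℕ) (n : Fin 5 ⊕ Fin 5) :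
    coordFun k (u + lead n) - tailCoeff n * coordFun k (u + tail n) = 0 := by
  rcases n with i | i
  · simp only [tailCoeff, zero_mul, sub_zero]
    by_cases h : deg u + 2 = level k
    · have hl : level k ≤ 3 := by clear h; revert k; decide
      obtain h0 | h0 : deg u = 0 ∨ deg u = 1 := by omega
      · obtain rfl := eq_zero_of_deg h0
        clear h h0 hl
        revert k i; decide
      · obtain ⟨v, j, hv, rfl⟩ := exists_add_single h0
        obtain rfl := eq_zero_of_deg hv
        clear h h0 hl hv
        revert k i j; decide
    · rw [coordFun, if_neg]
      rw [deg_add, deg_lead]; tauto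
  · have hw : reduced (weight (u + lead (.inr i))) = reduced (weight (u + tail (.inr i))) := by
      have : (weight (lead (.inr i))) % 11 = (weight (tail (.inr i))) % 11 ∧
        0 < weight (lead (.inr i)) ∧ 0 < weight (tail (.inr i)) := by revert i; decide
      rw [weight_add, weight_add, reduced, reduced]
      split_ifs <;> omega
    simp [coordFun, deg_add, deg_lead, deg_tail, hw, tailCoeff]

section Ideal

variable (K : Type) [Field K]

/-- The quadrics `xᵢxᵢ₊₂` and `xᵢ² - xᵢ₊₁xᵢ₊₂`, with cyclic indices, which are apolar to the Klein
cubic. -/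
noncomputable def quadric : Fin 5 ⊕ Fin 5 → MvPolynomial (Fin 5) K
  | .inl i => X i * X (i + 2)
  | .inr i => X i * X i - X (i + 1) * X (i + 2)

/-- The apolar ideal of the Klein cubic threefold. -/
noncomputable def kleinIdeal : Ideal (MvPolynomial (Fin 5) K) := Ideal.span (Set.range (quadric K))

theorem quadric_eq (n : Fin 5 ⊕ Fin 5) :
    quadric K n = mono K (lead n) - (tailCoeff n : K) • mono K (tail n) := by
  rcases n with i | i <;> simp [quadric, lead, tail, tailCoeff, mono_add, mono_single]

theorem functional_coordFun_eq_zero (k : Fin 12) {f : MvPolynomial (Fin 5) K}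
    (hf : f ∈ kleinIdeal K) : functional K (coordFun k) f = 0 := by
  refine functional_eq_zero_of_mem_span _ (quadric K) (fun u n => ?_) hf
  rw [quadric_eq, mul_sub, mul_smul_comm, ← mono_add, ← mono_add, map_sub, map_smul,
    functional_mono, functional_mono, smul_eq_mul]
  exact_mod_cast congrArg (Int.cast : ℤ → K) (coordFun_relation k u n)

theorem mk_quadric (n : Fin 5 ⊕ Fin 5) : Ideal.Quotient.mk (kleinIdeal K) (quadric K n) = 0 :=
  Ideal.Quotient.eq_zero_iff_mem.2 (Ideal.subset_span ⟨n, rfl⟩)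

end Ideal

section Relations

variable {S : Type*} [CommRing S]

/-- The cyclic quadratic relations of the apolar algebra of the Klein cubic. -/
def IsApolar (y : Fin 5 → S) : Prop :=
  ∀ i, y i * y (i + 2) = 0 ∧ y i * y i = y (i + 1) * y (i + 2)

variable {y : Fin 5 → S} (h : IsApolar y)

include h

theorem IsApolar.cube_eq_zero (i : Fin 5) : y i * (y i * y i) = 0 := by
  linear_combination y i * (h i).2 + y (i + 1) * (h i).1

theorem IsApolar.socle_succ (i : Fin 5) :
    y (i + 1) * y (i + 1) * y (i + 2) = y i * y i * y (i + 1) := by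
  rw [(h i).2]; ring

theorem IsApolar.socle_eq (i : Fin 5) : y i * y i * y (i + 1) = y 0 * y 0 * y 1 := by
  have k0 := h.socle_succ 0
  have k1 := h.socle_succ 1
  have k2 := h.socle_succ 2
  have k3 := h.socle_succ 3
  simp only [Fin.reduceAdd, zero_add] at k0 k1 k2 k3
  fin_cases i <;> simp [k0, k1, k2, k3]

theorem IsApolar.mul_eq (i j : Fin 5) : y i * y j = 0 ∨ ∃ l, y i * y j = y l * y l := by
  obtain ⟨m, rfl⟩ : ∃ m, j = i + m := ⟨j - i, by abel⟩
  have h3 := h (i + 3)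
  have h4 := h (i + 4)
  simp only [add_assoc, Fin.reduceAdd, add_zero] at h3 h4
  fin_cases m <;> simp only [Fin.mk_zero, Fin.mk_one, Fin.reduceFinMk, add_zero]
  · exact .inr ⟨i, rfl⟩
  · exact .inr ⟨i + 4, h4.2.symm⟩
  · exact .inl (h i).1
  · exact .inl (by rw [mul_comm]; exact h3.1)
  · exact .inr ⟨i + 3, by rw [mul_comm]; exact h3.2.symm⟩

theorem IsApolar.mul_sq_eq (i j : Fin 5) :
    y i * (y j * y j) = 0 ∨ y i * (y j * y j) = y 0 * y 0 * y 1 := by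
  obtain ⟨m, rfl⟩ : ∃ m, j = i + m := ⟨j - i, by abel⟩
  have h1 := h (i + 1)
  have h2 := h (i + 2)
  have h3 := h (i + 3)
  simp only [add_assoc, Fin.reduceAdd, add_zero] at h1 h2 h3
  fin_cases m <;> simp only [Fin.mk_zero, Fin.mk_one, Fin.reduceFinMk, add_zero]
  · exact .inl (h.cube_eq_zero i)
  · exact .inl (by linear_combination y i * h1.2 + y (i + 3) * (h i).1)
  · exact .inl (by linear_combination y (i + 2) * (h i).1)
  · exact .inl (by linear_combination y (i + 3) * h3.1)
  · refine .inr ?_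
    have := h.socle_eq (i + 4)
    simp only [add_assoc, Fin.reduceAdd, add_zero] at this
    rw [← this]; ring

theorem IsApolar.mul_socle (i : Fin 5) : y i * (y 0 * y 0 * y 1) = 0 := by
  rw [← h.socle_eq i]
  linear_combination y (i + 1) * h.cube_eq_zero i

end Relations

section Basis

variable (K : Type) [Field K]

theorem isApolar_mk : IsApolar fun i => Ideal.Quotient.mk (kleinIdeal K) (X i) := by
  intro i
  constructor
  · simpa [quadric] using mk_quadric K (.inl i)
  · simpa [quadric, sub_eq_zero] using mk_quadric K (.inr i)

theorem span_basisExp : Submodule.span K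
    (Set.range fun i => Ideal.Quotient.mk (kleinIdeal K) (mono K (basisExp i))) = ⊤ := by
  have h := isApolar_mk K
  set y : Fin 5 → MvPolynomial (Fin 5) K ⧸ kleinIdeal K :=
    fun i => Ideal.Quotient.mk (kleinIdeal K) (X i) with hy
  have hmk (v : Fin 5 → ℕ) : Ideal.Quotient.mk (kleinIdeal K) (mono K v) = ∏ i, y i ^ v i := by
    simp [mono_eq_prod, hy]
  simp only [hmk]
  set S := Submodule.span K (Set.range fun k => ∏ i, y i ^ basisExp k i) with hS
  have mem (k : Fin 12) : ∏ i, y i ^ basisExp k i ∈ S := Submodule.subset_span ⟨k, rfl⟩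
  have m0 : 1 ∈ S := by simpa [basisExp, Fin.prod_univ_succ] using mem 0
  have ms : y 0 * y 0 * y 1 ∈ S := by simpa [basisExp, Fin.prod_univ_succ, sq] using mem 11
  have m1 (i : Fin 5) : y i ∈ S := by
    have e1 := mem 1
    have e3 := mem 3
    have e4 := mem 4
    have e5 := mem 5
    have e9 := mem 9
    simp [basisExp, Fin.prod_univ_succ] at e1 e3 e4 e5 e9
    fin_cases i <;> assumption
  have m2 (i : Fin 5) : y i * y i ∈ S := by
    have e2 := mem 2
    have e7 := mem 7
    have e8 := mem 8
    have e6 := mem 6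
    have e10 := mem 10
    simp [basisExp, Fin.prod_univ_succ, sq] at e2 e7 e8 e6 e10
    fin_cases i <;> assumption
  have m11 (i j : Fin 5) : y i * y j ∈ S := by
    obtain h0 | ⟨l, h0⟩ := h.mul_eq i j <;> rw [h0]
    exacts [S.zero_mem, m2 l]
  have m12 (i j : Fin 5) : y i * (y j * y j) ∈ S := by
    obtain h0 | h0 := h.mul_sq_eq i j <;> rw [h0]
    exacts [S.zero_mem, ms]
  have m1s (i : Fin 5) : y i * (y 0 * y 0 * y 1) ∈ S := by
    rw [h.mul_socle i]; exact S.zero_mem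
  refine mk_mem_of_closed _ S m0 fun i x hx => ?_
  refine Submodule.span_induction (p := fun x _ => y i * x ∈ S) ?_ (by simp) ?_ ?_ hx
  · rintro _ ⟨k, rfl⟩
    have a0 := m1 i
    have a1 := m11 i
    have a2 := m12 i
    have a3 := m1s i
    fin_cases k <;> simp [basisExp, Fin.prod_univ_succ, sq, a0, a1, a2, a3]
  · intro a b _ _ ha hb
    rw [mul_add]; exact S.add_mem ha hb
  · intro r a _ ha
    rw [mul_smul_comm]; exact S.smul_mem r ha

theorem exists_kleinBasis :
    ∃ b : Module.Basis (Fin 12) K (MvPolynomial (Fin 5) K ⧸ kleinIdeal K),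
      (∀ i, b i = Ideal.Quotient.mk (kleinIdeal K) (mono K (basisExp i))) ∧
      ∀ i f, b.repr (Ideal.Quotient.mk (kleinIdeal K) f) i = functional K (coordFun i) f :=
  exists_basis_of_dual coordFun_basisExp (fun k _ hf => functional_coordFun_eq_zero K k hf)
    (span_basisExp K)

end Basis

section Gorenstein

variable (K : Type) [Field K]

theorem functional_homogeneousComponent (k : Fin 12) (d : ℕ) (f : MvPolynomial (Fin 5) K) :
    functional K (coordFun k) (homogeneousComponent d f) =
      if level k = d then functional K (coordFun k) f else 0 := by
  have key : functional K (coordFun k) ∘ₗ homogeneousComponent d =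
      if level k = d then functional K (coordFun k) else 0 := by
    refine linearMap_ext_mono fun v => ?_
    have hv : (mono K v).IsHomogeneous (deg v) := by
      simpa [deg, Fin.sum_univ_succ, add_assoc] using isHomogeneous_mono K v
    rw [LinearMap.comp_apply, homogeneousComponent_of_mem hv]
    have hne (h : level k ≠ deg v) : functional K (coordFun k) (mono K v) = 0 := by
      rw [functional_mono, coordFun, if_neg fun h' => h h'.1.symm, Int.cast_zero]
    by_cases h1 : level k = d
    · rw [if_pos h1]
      split_ifs with h2
      · rfl
      · rw [map_zero, hne fun h' => h2 (h1.symm.trans h')]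
    · rw [if_neg h1]
      split_ifs with h2
      · rw [hne fun h' => h1 (h'.trans h2.symm)]; rfl
      · rw [map_zero]; rfl
  have := LinearMap.congr_fun key f
  rw [LinearMap.comp_apply] at this
  rw [this]; split_ifs <;> rfl

theorem mem_kleinIdeal_iff (f : MvPolynomial (Fin 5) K) :
    f ∈ kleinIdeal K ↔ ∀ k, functional K (coordFun k) f = 0 := by
  obtain ⟨b, -, hb⟩ := exists_kleinBasis K
  rw [← Ideal.Quotient.eq_zero_iff_mem, ← b.repr.map_eq_zero_iff, Finsupp.ext_iff]
  simp [hb]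

theorem homogeneousComponent_mem (f : MvPolynomial (Fin 5) K) (hf : f ∈ kleinIdeal K) (d : ℕ) :
    homogeneousComponent d f ∈ kleinIdeal K := by
  rw [mem_kleinIdeal_iff] at hf ⊢
  intro k
  rw [functional_homogeneousComponent, hf, ite_self]

theorem deg_basisExp (k : Fin 12) : deg (basisExp k) = level k := by revert k; decide

theorem finrank_gradedPiece (t : ℕ) : Module.finrank K (gradedPiece K 5 (kleinIdeal K) t) =
    Fintype.card {k : Fin 12 // level k = t} := by
  obtain ⟨b, hb, hr⟩ := exists_kleinBasis K
  have hspan : gradedPiece K 5 (kleinIdeal K) t =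
      Submodule.span K (Set.range fun k : {k : Fin 12 // level k = t} => b k) := by
    apply le_antisymm
    · rintro _ ⟨f, hf, rfl⟩
      change Ideal.Quotient.mk _ f ∈ _
      rw [← b.sum_repr (Ideal.Quotient.mk _ f)]
      refine Submodule.sum_mem _ fun k _ => ?_
      by_cases hk : level k = t
      · exact Submodule.smul_mem _ _ (Submodule.subset_span ⟨⟨k, hk⟩, rfl⟩)
      · have hf' : homogeneousComponent t f = f := by
          rw [homogeneousComponent_of_mem hf, if_pos rfl]
        rw [hr, ← hf', functional_homogeneousComponent, if_neg hk, zero_smul]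
        exact Submodule.zero_mem _
    · rw [Submodule.span_le]
      rintro _ ⟨⟨k, rfl⟩, rfl⟩
      refine ⟨mono K (basisExp k), ?_, (hb k).symm⟩
      rw [← deg_basisExp]
      simpa [deg, Fin.sum_univ_succ, add_assoc] using isHomogeneous_mono K (basisExp k)
  rw [hspan]
  exact finrank_span_eq_card (b.linearIndependent.comp _ Subtype.val_injective)

/-- The functional reading off the socle coordinate of a product with the complementary basis
monomial recovers every coordinate. -/
theorem coordFun_top_mul (k l : Fin 12) :
    coordFun 11 (basisExp k + basisExp l) = if (k : ℕ) + l = 11 then 1 else 0 := by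
  revert k l; decide

theorem repr_mul_basis {b : Module.Basis (Fin 12) K (MvPolynomial (Fin 5) K ⧸ kleinIdeal K)}
    (hb : ∀ i, b i = Ideal.Quotient.mk (kleinIdeal K) (mono K (basisExp i)))
    (hr : ∀ i f, b.repr (Ideal.Quotient.mk (kleinIdeal K) f) i = functional K (coordFun i) f)
    (a : MvPolynomial (Fin 5) K ⧸ kleinIdeal K) (l : Fin 12) :
    b.repr (a * b l) 11 = b.repr a l.rev := by
  have key (k : Fin 12) : b.repr (b k * b l) 11 = if k = l.rev then 1 else 0 := by
    rw [hb, hb, ← map_mul, ← mono_add, hr, functional_mono, coordFun_top_mul]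
    have : (k : ℕ) + l = 11 ↔ k = l.rev := by
      rw [Fin.ext_iff, Fin.val_rev]; omega
    simp [this]
  conv_lhs => rw [← b.sum_repr a, Finset.sum_mul, map_sum, Finsupp.finsetSum_apply]
  simp only [smul_mul_assoc, map_smul, Finsupp.smul_apply, key, smul_eq_mul]
  simp

theorem mk_mono_mul_X_eq_zero (i : Fin 5) :
    Ideal.Quotient.mk (kleinIdeal K) (mono K (basisExp 11)) *
      Ideal.Quotient.mk (kleinIdeal K) (X i) = 0 := by
  rw [← map_mul, Ideal.Quotient.eq_zero_iff_mem, mem_kleinIdeal_iff, ← mono_single, ← mono_add]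
  intro k
  have : coordFun k (basisExp 11 + Pi.single i 1) = 0 := by revert k i; decide
  rw [functional_mono, this, Int.cast_zero]

theorem finrank_socle : Module.finrank K (socle K 5 (kleinIdeal K)) = 1 := by
  obtain ⟨b, hb, hr⟩ := exists_kleinBasis K
  have hs : socle K 5 (kleinIdeal K) = Submodule.span K {b 11} := by
    apply le_antisymm
    · intro a ha
      have ha' (i : Fin 5) : a * Ideal.Quotient.mk (kleinIdeal K) (X i) = 0 :=
        (Submodule.mem_iInf _).1 ha i
      have hz (k : Fin 12) (hk : k ≠ 11) : b.repr a k = 0 := by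
        have hl : 0 < level k.rev := by revert k; decide
        obtain ⟨v, j, -, hv⟩ := exists_add_single (n := level k.rev - 1) (u := basisExp k.rev)
          (by rw [deg_basisExp]; omega)
        have := repr_mul_basis K hb hr a k.rev
        rw [Fin.rev_rev, hb, hv, add_comm, mono_add, map_mul (Ideal.Quotient.mk _), ← mul_assoc,
          mono_single, ha', zero_mul, map_zero] at this
        exact this.symm
      rw [Submodule.mem_span_singleton]
      refine ⟨b.repr a 11, ?_⟩
      conv_rhs => rw [← b.sum_repr a]
      rw [Finset.sum_eq_single 11 (fun k _ hk => by rw [hz k hk, zero_smul]) (by simp)]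
    · rw [Submodule.span_singleton_le_iff_mem, hb]
      exact (Submodule.mem_iInf _).2 fun i => mk_mono_mul_X_eq_zero K i
  rw [hs, finrank_span_singleton (b.ne_zero 11)]

end Gorenstein

section Duality

variable {K R : Type*} [Field K] [CommRing R] [Algebra K R] (I : Ideal R)

/-- For a finite-dimensional quotient `R ⧸ I` with a nondegenerate trace, the normal module
`Hom(I, R ⧸ I)` is dual to the conormal module `I ⧸ I ^ 2`. -/
theorem finrank_hom_eq_finrank_cotangent [FiniteDimensional K (R ⧸ I)]
    (σ : (R ⧸ I) →ₗ[K] K) (hσ : ∀ a, (∀ c, σ (a * c) = 0) → a = 0) :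
    Module.finrank K (I →ₗ[R] R ⧸ I) = Module.finrank K I.Cotangent := by
  have : IsScalarTower K (R ⧸ I) I.Cotangent := ⟨fun k a m => by
    obtain ⟨r, rfl⟩ := Ideal.Quotient.mk_surjective a
    exact smul_assoc k r m⟩
  let D₀ : (R ⧸ I) →ₗ[K] Module.Dual K (R ⧸ I) := (LinearMap.mul K (R ⧸ I)).compr₂ σ
  have hD₀ : Function.Injective D₀ := by
    rw [← LinearMap.ker_eq_bot, LinearMap.ker_eq_bot']
    exact fun a ha => hσ a fun c => LinearMap.congr_fun ha c
  let D : (R ⧸ I) ≃ₗ[K] Module.Dual K (R ⧸ I) :=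
    LinearEquiv.ofInjectiveOfFinrankEq D₀ hD₀ Subspace.dual_finrank_eq.symm
  have hD (g : Module.Dual K (R ⧸ I)) (c) : σ (D.symm g * c) = g c :=
    LinearMap.congr_fun (D.apply_symm_apply g) c
  have ext' {a a' : R ⧸ I} (h : ∀ c, σ (a * c) = σ (a' * c)) : a = a' :=
    sub_eq_zero.1 <| hσ _ fun c => by rw [sub_mul, map_sub, h, sub_self]
  let Θ : Module.Dual K I.Cotangent →ₗ[K] (I →ₗ[R] R ⧸ I) :=
    { toFun ℓ :=
        { toFun x := D.symm (ℓ ∘ₗ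
            (LinearMap.toSpanSingleton (R ⧸ I) _ (I.toCotangent x)).restrictScalars K)
          map_add' x y := ext' fun c => by simp [hD, add_mul]
          map_smul' r x := ext' fun c => by
            rw [RingHom.id_apply, smul_mul_assoc, ← mul_smul_comm, hD, hD]
            simp [smul_comm c r] }
      map_add' ℓ ℓ' := LinearMap.ext fun x => ext' fun c => by simp [hD, add_mul]
      map_smul' r ℓ := LinearMap.ext fun x => ext' fun c => by simp [hD] }
  have hΘ (ℓ) (x : I) (c) : σ (Θ ℓ x * c) = ℓ (c • I.toCotangent x) := hD _ c
  have hinj : Function.Injective Θ := by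
    rw [← LinearMap.ker_eq_bot, LinearMap.ker_eq_bot']
    intro ℓ hℓ
    ext m
    obtain ⟨x, rfl⟩ := I.toCotangent_surjective m
    have := hΘ ℓ x 1
    rw [hℓ] at this
    simpa using this.symm
  have hsurj : Function.Surjective Θ := by
    intro φ
    let ψ : I.Cotangent →ₗ[R] R ⧸ I := Ideal.Cotangent.lift φ fun x y => by
      change φ ((x : R) • y) = 0
      rw [map_smul, Algebra.smul_def, Ideal.Quotient.algebraMap_eq,
        Ideal.Quotient.eq_zero_iff_mem.2 x.2, zero_mul]
    refine ⟨σ ∘ₗ ψ.restrictScalars K, LinearMap.ext fun x => ext' fun c => ?_⟩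
    obtain ⟨r, rfl⟩ := Ideal.Quotient.mk_surjective c
    have h1 : Ideal.Quotient.mk I r • I.toCotangent x = I.toCotangent (r • x) :=
      (map_smul I.toCotangent r x).symm
    rw [hΘ, h1, LinearMap.comp_apply, LinearMap.restrictScalars_apply,
      Ideal.Cotangent.lift_toCotangent, map_smul, Algebra.smul_def, mul_comm]
    rfl
  rw [← (LinearEquiv.ofBijective Θ ⟨hinj, hsurj⟩).finrank_eq, Subspace.dual_finrank_eq]

/-- The dimension of the conormal module, in terms of `R ⧸ I ^ 2` and `R ⧸ I`. -/
theorem finrank_cotangent_add [FiniteDimensional K (R ⧸ I ^ 2)] :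
    Module.finrank K I.Cotangent + Module.finrank K (R ⧸ I) = Module.finrank K (R ⧸ I ^ 2) := by
  let f : (R ⧸ I ^ 2) →ₗ[K] R ⧸ I :=
    (Ideal.Quotient.factorₐ K (Ideal.pow_le_self two_ne_zero)).toLinearMap
  have hf : Function.Surjective f :=
    Ideal.Quotient.factor_surjective (Ideal.pow_le_self two_ne_zero)
  let g : I.Cotangent →ₗ[K] R ⧸ I ^ 2 := I.cotangentToQuotientSquare.restrictScalars K
  have hg : Function.Injective g := I.cotangentToQuotientSquare_injective
  have hfg : LinearMap.range g = LinearMap.ker f := by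
    ext x
    obtain ⟨r, rfl⟩ := Ideal.Quotient.mk_surjective x
    have h1 : Ideal.Quotient.mk (I ^ 2) r ∈ LinearMap.ker f ↔ r ∈ I :=
      Ideal.Quotient.eq_zero_iff_mem
    rw [h1, ← Ideal.mk_mem_cotangentIdeal, ← Submodule.restrictScalars_mem R I.cotangentIdeal,
      ← Ideal.range_cotangentToQuotientSquare]
    rfl
  rw [← LinearMap.finrank_range_add_finrank_ker f, LinearMap.range_eq_top.2 hf, finrank_top,
    ← hfg, LinearMap.finrank_range_of_inj hg, add_comm]

end Duality

section SquareRelations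

variable {S : Type*} [CommRing S]

/-- The quadric generators evaluated at a tuple. -/
def quadricAt (y : Fin 5 → S) : Fin 5 ⊕ Fin 5 → S
  | .inl i => y i * y (i + 2)
  | .inr i => y i * y i - y (i + 1) * y (i + 2)

/-- The relations defining the square of the apolar ideal of the Klein cubic. -/
def IsSqApolar (y : Fin 5 → S) : Prop :=
  ∀ m n, quadricAt y m * quadricAt y n = 0

variable {y : Fin 5 → S} (h : IsSqApolar y)

include h

theorem IsSqApolar.shift (s : Fin 5) : IsSqApolar fun i => y (i + s) := by
  have key (n) : quadricAt (fun i => y (i + s)) n = quadricAt y (n.map (· + s) (· + s)) := by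
    rcases n with i | i <;> simp [quadricAt, add_right_comm]
  intro m n
  rw [key, key, h]

theorem IsSqApolar.quartic_residue :
    y 0 ^ 3 * y 1 = 3 * (y 0 * y 3 ^ 2 * y 4) - y 3 ^ 4 ∧
    y 0 ^ 2 * y 4 ^ 2 = 2 * (y 0 * y 3 ^ 2 * y 4) - y 3 ^ 4 ∧
    y 0 * y 1 ^ 2 * y 2 = y 0 * y 3 ^ 2 * y 4 ∧
    y 0 * y 2 ^ 2 * y 3 = y 0 * y 3 ^ 2 * y 4 ∧
    y 1 * y 2 * y 4 ^ 2 = 0 := by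
  have h06 : y 0 * y 2 * (y 1 * y 1 - y 2 * y 3) = 0 := h (.inl 0) (.inr 1)
  have h24 : y 2 * y 4 * (y 4 * y 1) = 0 := h (.inl 2) (.inl 4)
  have h37 : y 3 * y 0 * (y 2 * y 2 - y 3 * y 4) = 0 := h (.inl 3) (.inr 2)
  have h59 : (y 0 * y 0 - y 1 * y 2) * (y 4 * y 4 - y 0 * y 1) = 0 := h (.inr 0) (.inr 4)
  have h88 : (y 3 * y 3 - y 4 * y 0) * (y 3 * y 3 - y 4 * y 0) = 0 := h (.inr 3) (.inr 3)
  refine ⟨?_, ?_, ?_, ?_, ?_⟩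
  · linear_combination h06 - h24 + h37 - h59 + h88
  · linear_combination h88
  · linear_combination h06 + h37
  · linear_combination h37
  · linear_combination h24

theorem IsSqApolar.quartic_nonresidue :
    y 0 * y 1 ^ 2 * y 4 = -(y 2 * y 3 ^ 3) ∧
    y 0 * y 2 ^ 3 = 0 ∧
    y 0 * y 2 * y 3 * y 4 = 0 ∧
    y 1 ^ 2 * y 3 ^ 2 = 0 ∧
    y 1 * y 4 ^ 3 = -(y 2 * y 3 ^ 3) := by
  have h11 : y 1 * y 3 * (y 1 * y 3) = 0 := h (.inl 1) (.inl 1)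
  have h23 : y 2 * y 4 * (y 3 * y 0) = 0 := h (.inl 2) (.inl 3)
  have h07 : y 0 * y 2 * (y 2 * y 2 - y 3 * y 4) = 0 := h (.inl 0) (.inr 2)
  have h49 : y 4 * y 1 * (y 4 * y 4 - y 0 * y 1) = 0 := h (.inl 4) (.inr 4)
  have h68 : (y 1 * y 1 - y 2 * y 3) * (y 3 * y 3 - y 4 * y 0) = 0 := h (.inr 1) (.inr 3)
  refine ⟨?_, ?_, ?_, ?_, ?_⟩
  · linear_combination h11 + h23 - h68
  · linear_combination h07 + h23
  · linear_combination h23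
  · linear_combination h11
  · linear_combination h11 + h23 + h49 - h68

theorem IsSqApolar.quartic_zero : y 0 ^ 2 * y 2 * y 4 = y 0 * y 1 ^ 2 * y 3 := by
  have h08 : y 0 * y 2 * (y 3 * y 3 - y 4 * y 0) = 0 := h (.inl 0) (.inr 3)
  have h36 : y 3 * y 0 * (y 1 * y 1 - y 2 * y 3) = 0 := h (.inl 3) (.inr 1)
  linear_combination -h08 - h36

theorem IsSqApolar.quartic_zero_eq (s : Fin 5) :
    y s ^ 2 * y (2 + s) * y (4 + s) = y 0 ^ 2 * y 2 * y 4 := by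
  have key (s : Fin 5) : y s ^ 2 * y (2 + s) * y (4 + s) =
      y (s + 1) ^ 2 * y (2 + (s + 1)) * y (4 + (s + 1)) := by
    have := (h.shift s).quartic_zero
    simp only [zero_add] at this
    rw [this, show (2 : Fin 5) + (s + 1) = 3 + s by grind, show (4 : Fin 5) + (s + 1) = s by grind,
      add_comm 1 s]
    ring
  have k0 := key 0
  have k1 := key 1
  have k2 := key 2
  have k3 := key 3
  simp only [Fin.reduceAdd, zero_add, add_zero] at k0 k1 k2 k3
  fin_cases s <;> simp [k0, k1, k2, k3]

theorem IsSqApolar.mul_residue (i : Fin 5) : y i * (y 0 * y 3 ^ 2 * y 4) = 0 := by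
  have h33 : y 3 * y 0 * (y 3 * y 0) = 0 := h (.inl 3) (.inl 3)
  have h13 : y 1 * y 3 * (y 3 * y 0) = 0 := h (.inl 1) (.inl 3)
  have h23 : y 2 * y 4 * (y 3 * y 0) = 0 := h (.inl 2) (.inl 3)
  have h01 : y 0 * y 2 * (y 1 * y 3) = 0 := h (.inl 0) (.inl 1)
  have h02 : y 0 * y 2 * (y 2 * y 4) = 0 := h (.inl 0) (.inl 2)
  have h06 : y 0 * y 2 * (y 1 * y 1 - y 2 * y 3) = 0 := h (.inl 0) (.inr 1)
  have h37 : y 3 * y 0 * (y 2 * y 2 - y 3 * y 4) = 0 := h (.inl 3) (.inr 2)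
  fin_cases i <;> simp only [Fin.mk_zero, Fin.mk_one, Fin.reduceFinMk]
  · linear_combination y 4 * h33
  · linear_combination y 4 * h13
  · linear_combination y 3 * h23
  · linear_combination y 1 * h01 - y 3 * h06 - y 3 * h37
  · linear_combination y 3 * h02 - y 4 * h37

theorem IsSqApolar.mul_fourth_pow (i : Fin 5) : y i * y 3 ^ 4 = 0 := by
  have h11 : y 1 * y 3 * (y 1 * y 3) = 0 := h (.inl 1) (.inl 1)
  have h33 : y 3 * y 0 * (y 3 * y 0) = 0 := h (.inl 3) (.inl 3)
  have h13 : y 1 * y 3 * (y 3 * y 0) = 0 := h (.inl 1) (.inl 3)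
  have h23 : y 2 * y 4 * (y 3 * y 0) = 0 := h (.inl 2) (.inl 3)
  have h01 : y 0 * y 2 * (y 1 * y 3) = 0 := h (.inl 0) (.inl 1)
  have h06 : y 0 * y 2 * (y 1 * y 1 - y 2 * y 3) = 0 := h (.inl 0) (.inr 1)
  have h16 : y 1 * y 3 * (y 1 * y 1 - y 2 * y 3) = 0 := h (.inl 1) (.inr 1)
  have h37 : y 3 * y 0 * (y 2 * y 2 - y 3 * y 4) = 0 := h (.inl 3) (.inr 2)
  have h18 : y 1 * y 3 * (y 3 * y 3 - y 4 * y 0) = 0 := h (.inl 1) (.inr 3)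
  have h38 : y 3 * y 0 * (y 3 * y 3 - y 4 * y 0) = 0 := h (.inl 3) (.inr 3)
  have h66 : (y 1 * y 1 - y 2 * y 3) * (y 1 * y 1 - y 2 * y 3) = 0 := h (.inr 1) (.inr 1)
  have h68 : (y 1 * y 1 - y 2 * y 3) * (y 3 * y 3 - y 4 * y 0) = 0 := h (.inr 1) (.inr 3)
  have h78 : (y 2 * y 2 - y 3 * y 4) * (y 3 * y 3 - y 4 * y 0) = 0 := h (.inr 2) (.inr 3)
  have h88 : (y 3 * y 3 - y 4 * y 0) * (y 3 * y 3 - y 4 * y 0) = 0 := h (.inr 3) (.inr 3)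
  fin_cases i <;> simp only [Fin.mk_zero, Fin.mk_one, Fin.reduceFinMk]
  · linear_combination y 4 * h33 + y 3 * h38
  · linear_combination y 4 * h13 + y 3 * h18
  · linear_combination y 3 * h23 + y 1 * h18 - y 3 * h68
  · linear_combination y 1 * h01 - y 3 * h06 - y 3 * h37 + y 4 * h38 + y 3 * h88
  · linear_combination y 2 * h11 - y 1 * h16 - y 4 * h37 + y 3 * h66 - y 3 * h78

theorem IsSqApolar.mul_nonresidue (i : Fin 5) : y i * (y 2 * y 3 ^ 3) = 0 := by
  have h11 : y 1 * y 3 * (y 1 * y 3) = 0 := h (.inl 1) (.inl 1)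
  have h03 : y 0 * y 2 * (y 3 * y 0) = 0 := h (.inl 0) (.inl 3)
  have h23 : y 2 * y 4 * (y 3 * y 0) = 0 := h (.inl 2) (.inl 3)
  have h16 : y 1 * y 3 * (y 1 * y 1 - y 2 * y 3) = 0 := h (.inl 1) (.inr 1)
  have h36 : y 3 * y 0 * (y 1 * y 1 - y 2 * y 3) = 0 := h (.inl 3) (.inr 1)
  have h08 : y 0 * y 2 * (y 3 * y 3 - y 4 * y 0) = 0 := h (.inl 0) (.inr 3)
  have h28 : y 2 * y 4 * (y 3 * y 3 - y 4 * y 0) = 0 := h (.inl 2) (.inr 3)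
  have h66 : (y 1 * y 1 - y 2 * y 3) * (y 1 * y 1 - y 2 * y 3) = 0 := h (.inr 1) (.inr 1)
  have h68 : (y 1 * y 1 - y 2 * y 3) * (y 3 * y 3 - y 4 * y 0) = 0 := h (.inr 1) (.inr 3)
  fin_cases i <;> simp only [Fin.mk_zero, Fin.mk_one, Fin.reduceFinMk]
  · linear_combination y 4 * h03 + y 3 * h08
  · linear_combination y 1 * h11 - y 3 * h16
  · linear_combination y 2 * h11 - y 1 * h16 + y 3 * h66
  · linear_combination -y 3 * h68 + y 3 * h11 - y 4 * h36
  · linear_combination y 3 * h28 + y 4 * h23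

theorem IsSqApolar.mul_zero_quartic (i : Fin 5) : y i * (y 0 ^ 2 * y 2 * y 4) = 0 := by
  have h00 : y 0 * y 2 * (y 0 * y 2) = 0 := h (.inl 0) (.inl 0)
  have h02 : y 0 * y 2 * (y 2 * y 4) = 0 := h (.inl 0) (.inl 2)
  have h03 : y 0 * y 2 * (y 3 * y 0) = 0 := h (.inl 0) (.inl 3)
  have h04 : y 0 * y 2 * (y 4 * y 1) = 0 := h (.inl 0) (.inl 4)
  have h23 : y 2 * y 4 * (y 3 * y 0) = 0 := h (.inl 2) (.inl 3)
  have h05 : y 0 * y 2 * (y 0 * y 0 - y 1 * y 2) = 0 := h (.inl 0) (.inr 0)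
  have h08 : y 0 * y 2 * (y 3 * y 3 - y 4 * y 0) = 0 := h (.inl 0) (.inr 3)
  fin_cases i <;> simp only [Fin.mk_zero, Fin.mk_one, Fin.reduceFinMk]
  · linear_combination y 1 * h02 + y 4 * h05
  · linear_combination y 0 * h04
  · linear_combination y 4 * h00
  · linear_combination y 4 * h03
  · linear_combination -y 4 * h08 + y 3 * h23

end SquareRelations

/-- The exponent vectors of the basis quartics of the conormal module, up to cyclic shift. -/
def quarticBase : Fin 3 → Fin 5 → ℕ := ![![1, 0, 0, 2, 1], ![0, 0, 0, 4, 0], ![0, 0, 1, 3, 0]]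

/-- The quartic functionals, up to cyclic shift, on monomials. -/
def quarticBaseFun (m : Fin 3) (w : Fin 5 → ℕ) : ℤ :=
  if w = ![1, 0, 0, 2, 1] then ![1, 0, 0] m else
  if w = ![0, 0, 0, 4, 0] then ![0, 1, 0] m else
  if w = ![0, 0, 1, 3, 0] then ![0, 0, 1] m else
  if w = ![3, 1, 0, 0, 0] then ![3, -1, 0] m else
  if w = ![2, 0, 0, 0, 2] then ![2, -1, 0] m else
  if w = ![1, 2, 1, 0, 0] ∨ w = ![1, 0, 2, 1, 0] then ![1, 0, 0] m else
  if w = ![1, 2, 0, 0, 1] ∨ w = ![0, 1, 0, 0, 3] then ![0, 0, -1] m else 0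

/-- The index type of a monomial basis of `R ⧸ I ^ 2`. -/
abbrev SqIndex : Type :=
  {v : Fin 5 → Fin 4 // ∑ i, (v i : ℕ) ≤ 3} ⊕ (Fin 5 × Fin 3 ⊕ Unit)

theorem card_sqIndex : Fintype.card SqIndex = 72 := by
  decide +kernel

/-- The exponent vectors of a monomial basis of `R ⧸ I ^ 2`. -/
def sqExp : SqIndex → Fin 5 → ℕ
  | .inl v => fun i => v.1 i
  | .inr (.inl (s, m)) => fun i => quarticBase m (i - s)
  | .inr (.inr _) => ![2, 0, 1, 0, 1]

/-- The functionals dual to the monomial basis of `R ⧸ I ^ 2`, on monomials. -/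
def sqFun : SqIndex → (Fin 5 → ℕ) → ℤ
  | .inl u => fun v => if v = fun i => (u.1 i : ℕ) then 1 else 0
  | .inr (.inl (s, m)) => fun v => if deg v = 4 then quarticBaseFun m fun i => v (i + s) else 0
  | .inr (.inr _) => fun v => if deg v = 4 ∧ weight v % 11 = 0 then 1 else 0

theorem deg_le_three (v : {v : Fin 5 → Fin 4 // ∑ i, (v i : ℕ) ≤ 3}) :
    deg (fun i => (v.1 i : ℕ)) ≤ 3 := by
  simpa [deg, Fin.sum_univ_succ, add_assoc] using v.2

theorem sqFun_sqExp (i j : SqIndex) : sqFun i (sqExp j) = if i = j then 1 else 0 := by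
  have h4 (j) : deg (sqExp (.inr j)) = 4 := by revert j; decide
  rcases i with u | i <;> rcases j with v | j
  · have : ((fun i => (v.1 i : ℕ)) = fun i => (u.1 i : ℕ)) ↔ u = v := by
      simp only [funext_iff, Subtype.ext_iff, Fin.val_inj]
      exact forall_congr' fun _ => eq_comm
    simp [sqFun, sqExp, this]
  · have : sqExp (.inr j) ≠ fun i => (u.1 i : ℕ) := fun h => by
      have := h4 j
      rw [h] at this
      have := deg_le_three u
      omega
    simp [sqFun, this]
  · have : deg (sqExp (.inl v)) ≠ 4 := (lt_of_le_of_lt (deg_le_three v) (by simp)).ne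
    rcases i with ⟨s, m⟩ | _ <;> simp [sqFun, this]
  · have : ∀ i j : Fin 5 × Fin 3 ⊕ Unit,
      sqFun (.inr i) (sqExp (.inr j)) = if i = j then 1 else 0 := by decide
    simp [this]

theorem sqFun_relation_zero (i : Fin 5 × Fin 3 ⊕ Unit) (m n : Fin 5 ⊕ Fin 5) :
    sqFun (.inr i) (lead m + lead n) - tailCoeff n * sqFun (.inr i) (lead m + tail n) -
      tailCoeff m * sqFun (.inr i) (tail m + lead n) +
      tailCoeff m * tailCoeff n * sqFun (.inr i) (tail m + tail n) = 0 := by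
  revert i m n
  decide +kernel

theorem sqFun_eq_zero {i : SqIndex} {v : Fin 5 → ℕ} (h4 : 4 ≤ deg v)
    (h : i.isLeft ∨ deg v ≠ 4) : sqFun i v = 0 := by
  rcases i with u | ⟨s, m⟩ | _
  · have : v ≠ fun i => (u.1 i : ℕ) := by
      rintro rfl
      have := deg_le_three u
      omega
    simp [sqFun, this]
  · simp at h
    simp [sqFun, h]
  · simp at h
    simp [sqFun, h]

theorem sqFun_relation (i : SqIndex) (u : Fin 5 → ℕ) (m n : Fin 5 ⊕ Fin 5) :
    sqFun i (u + (lead m + lead n)) - tailCoeff n * sqFun i (u + (lead m + tail n)) -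
      tailCoeff m * sqFun i (u + (tail m + lead n)) +
      tailCoeff m * tailCoeff n * sqFun i (u + (tail m + tail n)) = 0 := by
  by_cases hi : i.isLeft ∨ deg u ≠ 0
  · have key (v w : Fin 5 → ℕ) (hv : deg v = 2) (hw : deg w = 2) : sqFun i (u + (v + w)) = 0 := by
      have : deg (u + (v + w)) = deg u + 4 := by simp [deg_add, hv, hw]
      exact sqFun_eq_zero (by omega) (hi.imp_right (by omega))
    simp [key, deg_lead, deg_tail]
  · push Not at hi
    obtain rfl := eq_zero_of_deg hi.2
    rcases i with v | i
    · simp at hi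
    · simpa only [zero_add] using sqFun_relation_zero i m n

/-- The exponent vectors of the quartic monomials in five variables, up to cyclic shift. -/
def quarticExp : Fin 14 → Fin 5 → ℕ :=
  ![![3, 1, 0, 0, 0], ![2, 0, 0, 0, 2], ![1, 2, 1, 0, 0], ![1, 0, 2, 1, 0], ![0, 1, 1, 0, 2],
    ![1, 0, 0, 2, 1], ![0, 0, 0, 4, 0], ![1, 2, 0, 0, 1], ![1, 0, 3, 0, 0], ![1, 0, 1, 1, 1],
    ![0, 2, 0, 2, 0], ![0, 1, 0, 0, 3], ![0, 0, 1, 3, 0], ![2, 0, 1, 0, 1]]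

theorem exists_quarticExp (v : Fin 5 → ℕ) (hv : deg v = 4) :
    ∃ s t, ∀ i, v i = quarticExp t (i - s) := by
  have key : ∀ w : Fin 5 → Fin 5, deg (fun i => w i) = 4 →
      ∃ s t, ∀ i, (w i : ℕ) = quarticExp t (i - s) := by
    decide +kernel
  have hlt (i) : v i < 5 := by
    simp only [deg] at hv
    fin_cases i <;> simp <;> omega
  exact key (fun i => ⟨v i, hlt i⟩) hv

theorem prod_pow_sub {S : Type*} [CommRing S] (y : Fin 5 → S) (w : Fin 5 → ℕ) (s : Fin 5) :
    ∏ i, y i ^ w (i - s) = ∏ i, y (i + s) ^ w i :=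
  Fintype.prod_equiv (Equiv.subRight s) _ _ fun i => by simp

section Span

variable (K : Type) [Field K] {S : Type*} [CommRing S] [Algebra K S] {y : Fin 5 → S}

theorem IsSqApolar.quartic_mem (h : IsSqApolar y) (T : Submodule K S)
    (hr : ∀ s, y s * y (3 + s) ^ 2 * y (4 + s) ∈ T) (hp : ∀ s, y (3 + s) ^ 4 ∈ T)
    (hn : ∀ s, y (2 + s) * y (3 + s) ^ 3 ∈ T) (hz : y 0 ^ 2 * y 2 * y 4 ∈ T)
    (v : Fin 5 → ℕ) (hv : deg v = 4) : ∏ i, y i ^ v i ∈ T := by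
  obtain ⟨s, t, hst⟩ := exists_quarticExp v hv
  simp only [hst, prod_pow_sub]
  obtain ⟨r1, r2, r3, r4, r5⟩ := (h.shift s).quartic_residue
  obtain ⟨n1, n2, n3, n4, n5⟩ := (h.shift s).quartic_nonresidue
  have z := h.quartic_zero_eq s
  specialize hr s
  specialize hp s
  specialize hn s
  simp only [zero_add] at *
  have h3 := T.smul_mem (3 : K) hr
  have h2 := T.smul_mem (2 : K) hr
  simp only [Algebra.smul_def, map_ofNat] at h2 h3
  fin_cases t <;>
    simp only [quarticExp, Fin.prod_univ_succ, Fin.mk_zero, Fin.mk_one, Fin.reduceFinMk] <;>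
    simp <;> simp only [← mul_assoc] at * <;>
    first
      | assumption
      | simpa only [r1] using T.sub_mem h3 hp
      | simpa only [r2] using T.sub_mem h2 hp
      | simpa only [r3] using hr
      | simpa only [r4] using hr
      | simpa only [r5] using T.zero_mem
      | simpa only [n1] using T.neg_mem hn
      | simpa only [n2] using T.zero_mem
      | simpa only [n3] using T.zero_mem
      | simpa only [n4] using T.zero_mem
      | simpa only [n5] using T.neg_mem hn
      | simpa only [z] using hz

theorem functional_sqFun_eq_zero (k : SqIndex) {f : MvPolynomial (Fin 5) K}
    (hf : f ∈ kleinIdeal K ^ 2) : functional K (sqFun k) f = 0 := by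
  have hI : kleinIdeal K ^ 2 = Ideal.span
      (Set.range fun p : (Fin 5 ⊕ Fin 5) × (Fin 5 ⊕ Fin 5) => quadric K p.1 * quadric K p.2) := by
    rw [sq, kleinIdeal, Ideal.span_mul_span', ← Set.image2_mul, Set.image2_range]
  rw [hI] at hf
  refine functional_eq_zero_of_mem_span _ _ (fun u p => ?_) hf
  obtain ⟨m, n⟩ := p
  have key : mono K u * (quadric K m * quadric K n) = mono K (u + (lead m + lead n)) -
      (tailCoeff n : K) • mono K (u + (lead m + tail n)) -
      (tailCoeff m : K) • mono K (u + (tail m + lead n)) +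
      (tailCoeff m * tailCoeff n : K) • mono K (u + (tail m + tail n)) := by
    simp only [quadric_eq, mono_add, Algebra.smul_def, map_mul]
    ring
  simp only [key, map_add, map_sub, map_smul, functional_mono, smul_eq_mul]
  exact_mod_cast congrArg (Int.cast : ℤ → K) (sqFun_relation k u m n)

theorem isSqApolar_mk : IsSqApolar fun i => Ideal.Quotient.mk (kleinIdeal K ^ 2) (X i) := by
  have key (n) : quadricAt (fun i => Ideal.Quotient.mk (kleinIdeal K ^ 2) (X i)) n =
      Ideal.Quotient.mk (kleinIdeal K ^ 2) (quadric K n) := by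
    rcases n with i | i <;> simp [quadricAt, quadric]
  intro m n
  rw [key, key, ← map_mul, Ideal.Quotient.eq_zero_iff_mem, sq]
  exact Ideal.mul_mem_mul (Ideal.subset_span ⟨m, rfl⟩) (Ideal.subset_span ⟨n, rfl⟩)

theorem span_sqExp : Submodule.span K
    (Set.range fun i => Ideal.Quotient.mk (kleinIdeal K ^ 2) (mono K (sqExp i))) = ⊤ := by
  have h := isSqApolar_mk K
  set y : Fin 5 → MvPolynomial (Fin 5) K ⧸ kleinIdeal K ^ 2 :=
    fun i => Ideal.Quotient.mk (kleinIdeal K ^ 2) (X i) with hy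
  have hmk (v : Fin 5 → ℕ) :
      Ideal.Quotient.mk (kleinIdeal K ^ 2) (mono K v) = ∏ i, y i ^ v i := by
    simp [mono_eq_prod, hy]
  simp only [hmk]
  set T := Submodule.span K (Set.range fun k => ∏ i, y i ^ sqExp k i) with hT
  have mem (k : SqIndex) : ∏ i, y i ^ sqExp k i ∈ T := Submodule.subset_span ⟨k, rfl⟩
  have low (v : Fin 5 → ℕ) (hv : deg v ≤ 3) : ∏ i, y i ^ v i ∈ T := by
    have hlt (i) : v i < 4 := by
      simp only [deg] at hv
      fin_cases i <;> simp <;> omega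
    exact mem (.inl ⟨fun i => ⟨v i, hlt i⟩, by
      simpa [deg, Fin.sum_univ_succ, add_assoc] using hv⟩)
  have quartic (s m) : ∏ i, y (i + s) ^ quarticBase m i ∈ T := by
    simpa only [sqExp, prod_pow_sub] using mem (.inr (.inl (s, m)))
  have hq := h.quartic_mem K T
    (fun s => by simpa [quarticBase, Fin.prod_univ_succ, mul_assoc] using quartic s 0)
    (fun s => by simpa [quarticBase, Fin.prod_univ_succ, mul_assoc] using quartic s 1)
    (fun s => by simpa [quarticBase, Fin.prod_univ_succ, mul_assoc] using quartic s 2)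
    (by simpa [sqExp, Fin.prod_univ_succ, mul_assoc] using mem (.inr (.inr ())))
  refine mk_mem_of_closed _ T (by simpa using low 0 (by simp [deg])) fun i x hx => ?_
  refine Submodule.span_induction (p := fun x _ => y i * x ∈ T) ?_ (by simp) ?_ ?_ hx
  · rintro _ ⟨v | ⟨s, m⟩ | _, rfl⟩
    · have hv : deg (sqExp (.inl v) + Pi.single i 1) ≤ 4 := by
        have h1 : deg (Pi.single i 1) = 1 := by clear hx; revert i; decide
        have := deg_le_three v
        rw [deg_add, h1]
        exact Nat.succ_le_succ this
      have : y i * ∏ j, y j ^ sqExp (.inl v) j =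
          ∏ j, y j ^ (sqExp (.inl v) + Pi.single i 1 : Fin 5 → ℕ) j := by
        rw [← hmk, ← hmk, mono_add, mono_single, map_mul, mul_comm]
      simp only [this]
      rcases hv.lt_or_eq with hv | hv
      exacts [low _ (Nat.le_of_lt_succ hv), hq _ hv]
    · have hs := h.shift s
      have r := hs.mul_residue (i - s)
      have p := hs.mul_fourth_pow (i - s)
      have n := hs.mul_nonresidue (i - s)
      simp only [sub_add_cancel, zero_add] at r p n
      have : y i * ∏ j, y j ^ sqExp (.inr (.inl (s, m))) j = 0 := by
        simp only [sqExp, prod_pow_sub]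
        simp only [mul_assoc] at r p n
        fin_cases m <;> simpa [quarticBase, Fin.prod_univ_succ, mul_assoc]
      simp only [this, T.zero_mem]
    · have : y i * ∏ j, y j ^ sqExp (.inr (.inr ())) j = 0 := by
        simpa [sqExp, Fin.prod_univ_succ, mul_assoc] using h.mul_zero_quartic i
      simp only [this, T.zero_mem]
  · intro a b _ _ ha hb
    rw [mul_add]; exact T.add_mem ha hb
  · intro r a _ ha
    rw [mul_smul_comm]; exact T.smul_mem r ha

theorem exists_sqBasis :
    ∃ b : Module.Basis SqIndex K (MvPolynomial (Fin 5) K ⧸ kleinIdeal K ^ 2),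
      ∀ i, b i = Ideal.Quotient.mk (kleinIdeal K ^ 2) (mono K (sqExp i)) :=
  (exists_basis_of_dual sqFun_sqExp (fun k _ hf => functional_sqFun_eq_zero K k hf)
    (span_sqExp K)).imp fun _ hb => hb.1

theorem finrank_hom : Module.finrank K
    (kleinIdeal K →ₗ[MvPolynomial (Fin 5) K] (MvPolynomial (Fin 5) K ⧸ kleinIdeal K)) = 60 := by
  obtain ⟨b, hb, hr⟩ := exists_kleinBasis K
  obtain ⟨c, -⟩ := exists_sqBasis K
  have := b.finiteDimensional_of_finite
  have := c.finiteDimensional_of_finite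
  rw [finrank_hom_eq_finrank_cotangent (kleinIdeal K) (b.coord 11) fun a ha => ?_]
  · have h := finrank_cotangent_add (K := K) (kleinIdeal K)
    rw [Module.finrank_eq_card_basis b, Module.finrank_eq_card_basis c, card_sqIndex,
      Fintype.card_fin] at h
    omega
  · refine b.ext_elem fun k => ?_
    have := repr_mul_basis K hb hr a k.rev
    rw [Fin.rev_rev] at this
    rw [← this, map_zero]
    exact ha _

end Span

end KleinCubic

namespace KleinCubic

open TensorProduct

theorem etale_of_adjoin_eq_top {L A : Type*} [Field L] [CharZero L] [CommRing A] [Algebra L A]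
    [Module.Finite L A] {u : A} (hu : u ^ 12 = u) (h : Algebra.adjoin L {u} = ⊤) :
    Algebra.Etale L A := by
  have hu' : KaehlerDifferential.D L A u = 0 := by
    have h1 : (12 : L) • u ^ 11 • KaehlerDifferential.D L A u = KaehlerDifferential.D L A u := by
      have := (KaehlerDifferential.D L A).leibniz_pow u 12
      rw [hu] at this
      conv_rhs => rw [this, ← Nat.cast_smul_eq_nsmul L]
      norm_num
    have h2 : u • KaehlerDifferential.D L A u = 0 := by
      have h3 := congrArg (u • ·) h1
      simp only [smul_comm u (12 : L), smul_smul u, ← pow_succ', Nat.reduceAdd, hu] at h3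
      have h4 : (11 : L) • u • KaehlerDifferential.D L A u = 0 := by
        rw [show (11 : L) = 12 - 1 by norm_num, sub_smul, h3, one_smul, sub_self]
      exact (smul_eq_zero.1 h4).resolve_left (by norm_num)
    rw [← h1, pow_succ, mul_smul, h2, smul_zero, smul_zero]
  have hD (a : A) : KaehlerDifferential.D L A a = 0 := by
    refine Derivation.eqOn_adjoin (D2 := 0) (s := {u}) ?_ 
      (h ▸ Algebra.mem_top : a ∈ Algebra.adjoin L {u})
    rintro _ rfl
    exact hu'
  have : Algebra.FormallyUnramified L A := by
    refine ⟨subsingleton_of_forall_eq 0 fun m => ?_⟩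
    have hm : m ∈ (⊤ : Submodule A (Ω[A⁄L])) := trivial
    rw [← KaehlerDifferential.span_range_derivation, Submodule.span_eq_bot.2] at hm
    · exact hm
    · rintro _ ⟨a, rfl⟩
      exact hD a
  have := Algebra.FormallyEtale.of_formallyUnramified_of_field L A
  exact ⟨inferInstance, Algebra.FinitePresentation.of_finiteType.1 inferInstance⟩

/-- The index of the product of two basis elements in the deformed algebra. -/
def mulIndex (k l : Fin 12) : Fin 12 :=
  ⟨reduced (k + l), by simp only [reduced]; split_ifs <;> omega⟩

/-- The order of vanishing of the product of two basis elements in the deformed algebra. -/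
def mulOrder (k l : Fin 12) : ℕ := level k + level l - level (mulIndex k l)

theorem level_mulIndex_add (k l : Fin 12) :
    level (mulIndex k l) + mulOrder k l = level k + level l := by
  revert k l
  decide

/-- A basis of an algebra whose multiplication table is that of the deformation of the apolar
algebra of the Klein cubic along `t`. -/
structure IsDeformed {P B : Type*} [CommRing P] [CommRing B] [Algebra P B] (t : P)
    (β : Module.Basis (Fin 12) P B) : Prop where
  zero : β 0 = 1
  mul (k l : Fin 12) : β k * β l = t ^ mulOrder k l • β (mulIndex k l)

section Etale

variable {P B : Type*} [CommRing P] [CommRing B] [Algebra P B] {t : P}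
  {β : Module.Basis (Fin 12) P B}

theorem IsDeformed.etale_baseChange (h : IsDeformed t β) (L : Type*) [Field L] [CharZero L]
    [Algebra P L] (ht : algebraMap P L t ≠ 0) : Algebra.Etale L (L ⊗[P] B) := by
  have := Module.Finite.of_basis β
  set τ := algebraMap P L t with hτ
  set e : Fin 12 → L ⊗[P] B := fun k => (τ ^ level k)⁻¹ ⊗ₜ β k with he
  have e_mul (k l) : e k * e l = e (mulIndex k l) := by
    simp only [he, Algebra.TensorProduct.tmul_mul_tmul, h.mul, TensorProduct.tmul_smul,
      TensorProduct.smul_tmul']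
    rw [Algebra.smul_def, map_pow, ← hτ]
    congr 1
    have := congrArg (τ ^ ·) (level_mulIndex_add k l)
    simp only [pow_add] at this
    field_simp
    linear_combination this
  have e_zero : e 0 = 1 := by simp [he, level, h.zero, Algebra.TensorProduct.one_def]
  have e_pow : ∀ n (hn : n < 12), e ⟨n, hn⟩ = e 1 ^ n := by
    intro n
    induction n with
    | zero => intro; simpa using e_zero
    | succ n ih =>
      intro hn
      rw [pow_succ, ← ih (by omega), e_mul]
      congr 1
      simp only [mulIndex, reduced]
      ext
      simp
      omega
  have e_one : e 1 ^ 12 = e 1 := by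
    rw [pow_succ, ← e_pow 11 (by norm_num), e_mul]
    rfl
  refine etale_of_adjoin_eq_top e_one (top_le_iff.1 ?_)
  rw [← Subalgebra.toSubmodule.le_iff_le, Algebra.top_toSubmodule,
    ← (Algebra.TensorProduct.basis L β).span_eq, Submodule.span_le]
  rintro _ ⟨k, rfl⟩
  have : Algebra.TensorProduct.basis L β k = τ ^ level k • e k := by
    simp [he, TensorProduct.smul_tmul', ht]
  rw [this, e_pow k k.2]
  exact Submodule.smul_mem _ _ (pow_mem (Algebra.self_mem_adjoin_singleton L _) _)

end Etale

section Exists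

open Polynomial

variable (P : Type*) [CommRing P] [IsDomain P] {t : P}

theorem exists_isDeformed (ht : t ≠ 0) :
    ∃ (B : Subalgebra P (AdjoinRoot (X ^ 12 - X : P[X]))) (β : Module.Basis (Fin 12) P B),
      IsDeformed t β := by
  set f : P[X] := X ^ 12 - X with hf
  have hdeg : (X : P[X]).degree < (12 : ℕ) := by
    rw [degree_X]; norm_num
  have hmonic : f.Monic := monic_X_pow_sub hdeg
  have hnat : f.natDegree = 12 := by rw [hf]; compute_degree!
  set g := AdjoinRoot.root f with hg
  have g_pow : g ^ 12 = g := by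
    have := AdjoinRoot.eval₂_root f
    simpa [hf, sub_eq_zero] using this
  have g_reduced (n : ℕ) : g ^ n = g ^ reduced n := by
    induction n using Nat.strong_induction_on with
    | _ n ih =>
      rcases lt_or_ge n 12 with hn | hn
      · congr 1
        simp only [reduced]; split_ifs <;> omega
      · obtain ⟨m, rfl⟩ := Nat.exists_eq_add_of_le hn
        rw [pow_add, g_pow, ← pow_succ', ih (m + 1) (by omega)]
        congr 1
        simp only [reduced]; split_ifs <;> omega
  have hli : LinearIndependent P fun k : Fin 12 => g ^ (k : ℕ) := by
    have := (AdjoinRoot.powerBasis' hmonic).basis.linearIndependent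
    rw [PowerBasis.coe_basis] at this
    exact this.comp (Fin.cast hnat.symm) (Fin.cast_injective _)
  set v : Fin 12 → AdjoinRoot f := fun k => t ^ level k • g ^ (k : ℕ) with hv
  have hvli : LinearIndependent P v := by
    rw [Fintype.linearIndependent_iff] at hli ⊢
    intro c hc k
    simp only [hv, smul_smul] at hc
    exact (mul_eq_zero.1 (hli _ hc k)).resolve_right (pow_ne_zero _ ht)
  have v_zero : v 0 = 1 := by simp [hv, level]
  have v_mul (k l) : v k * v l = t ^ mulOrder k l • v (mulIndex k l) := by
    simp only [hv, smul_mul_smul_comm, ← pow_add, smul_smul, g_reduced (k + l),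
      ← level_mulIndex_add, add_comm (mulOrder k l)]
    rfl
  set S := Submodule.span P (Set.range v) with hS
  have mem (k) : v k ∈ S := Submodule.subset_span ⟨k, rfl⟩
  have mul_mem (x y) (hx : x ∈ S) (hy : y ∈ S) : x * y ∈ S := by
    have : S * S ≤ S := by
      rw [hS, Submodule.span_mul_span, Submodule.span_le]
      rintro _ ⟨_, ⟨k, rfl⟩, _, ⟨l, rfl⟩, rfl⟩
      simp only [v_mul]
      exact S.smul_mem _ (mem _)
    exact this (Submodule.mul_mem_mul hx hy)
  let B := S.toSubalgebra (v_zero ▸ mem 0) mul_mem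
  let w : Fin 12 → B := fun k => ⟨v k, mem k⟩
  have hwli : LinearIndependent P w :=
    LinearIndependent.of_comp B.val.toLinearMap (by exact hvli)
  have hwspan : ⊤ ≤ Submodule.span P (Set.range w) := by
    rintro ⟨x, hx⟩ -
    refine Submodule.span_induction
      (p := fun x hx => (⟨x, hx⟩ : B) ∈ Submodule.span P (Set.range w)) ?_ ?_ ?_ ?_ hx
    · rintro _ ⟨k, rfl⟩
      exact Submodule.subset_span ⟨k, rfl⟩
    · exact Submodule.zero_mem _
    · intro x y hx hy h1 h2
      exact Submodule.add_mem _ h1 h2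
    · intro a x hx h
      exact Submodule.smul_mem _ a h
  refine ⟨B, Module.Basis.mk hwli hwspan, ?_, fun k l => ?_⟩
  · rw [Module.Basis.mk_apply]
    exact Subtype.ext v_zero
  · simp only [Module.Basis.mk_apply]
    exact Subtype.ext (v_mul k l)

end Exists

end KleinCubic

namespace KleinCubic

open MvPolynomial

/-- The index of the deformed basis element lifting each variable. -/
def varIndex : Fin 5 → Fin 12 := ![1, 9, 4, 3, 5]

section Fiber

variable {K B : Type} [Field K] [CommRing B] [Algebra (PowerSeries K) B] [Algebra K B]
  {β : Module.Basis (Fin 12) (PowerSeries K) B}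

theorem IsDeformed.aeval_basisExp (h : IsDeformed (PowerSeries.X : PowerSeries K) β) (k : Fin 12) :
    aeval (fun i => β (varIndex i)) (mono K (basisExp k)) = β k := by
  have h0 := h.zero
  have hm := h.mul
  rw [mono_eq_prod]
  simp only [map_prod, map_pow, aeval_X]
  fin_cases k <;>
    simp [basisExp, Fin.prod_univ_succ, varIndex, sq, hm, h0, mulIndex, mulOrder, reduced, level]

theorem IsDeformed.aeval_quadric_mem (h : IsDeformed (PowerSeries.X : PowerSeries K) β)
    (n : Fin 5 ⊕ Fin 5) : aeval (fun i => β (varIndex i)) (quadric K n) ∈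
      Ideal.span {algebraMap (PowerSeries K) B PowerSeries.X} := by
  rcases n with i | i
  · have hi : mulOrder (varIndex i) (varIndex (i + 2)) ≠ 0 := by revert i; decide
    simp only [quadric, map_mul, aeval_X, h.mul, Algebra.smul_def, map_pow]
    exact Ideal.mul_mem_right _ _ (Ideal.pow_mem_of_mem _ (Ideal.mem_span_singleton_self _) _
      (Nat.pos_of_ne_zero hi))
  · have hi : mulIndex (varIndex i) (varIndex i) = mulIndex (varIndex (i + 1)) (varIndex (i + 2)) ∧
      mulOrder (varIndex i) (varIndex i) = mulOrder (varIndex (i + 1)) (varIndex (i + 2)) := by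
      revert i; decide
    simp [quadric, h.mul, hi]

theorem IsDeformed.nonempty_fiber_algEquiv [IsScalarTower K (PowerSeries K) B]
    (h : IsDeformed (PowerSeries.X : PowerSeries K) β) :
    Nonempty ((B ⧸ Ideal.span {algebraMap (PowerSeries K) B PowerSeries.X}) ≃ₐ[K]
      (MvPolynomial (Fin 5) K ⧸ kleinIdeal K)) := by
  set J : Ideal B := Ideal.span {algebraMap (PowerSeries K) B PowerSeries.X} with hJ
  obtain ⟨b, hb, -⟩ := exists_kleinBasis K
  have hker : kleinIdeal K ≤ RingHom.ker
      ((Ideal.Quotient.mkₐ K J).comp (aeval fun i => β (varIndex i))) := by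
    rw [kleinIdeal, Ideal.span_le]
    rintro _ ⟨n, rfl⟩
    exact Ideal.Quotient.eq_zero_iff_mem.2 (h.aeval_quadric_mem n)
  let φ : (MvPolynomial (Fin 5) K ⧸ kleinIdeal K) →ₐ[K] B ⧸ J :=
    Ideal.Quotient.liftₐ (kleinIdeal K) _ fun a ha => hker ha
  have φ_basis (k) : φ (b k) = Ideal.Quotient.mk J (β k) := by
    rw [hb, ← h.aeval_basisExp k]
    rfl
  have φ_sum (c : Fin 12 → K) : φ (∑ k, c k • b k) =
      Ideal.Quotient.mk J (∑ k, PowerSeries.C (c k) • β k) := by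
    simp only [map_sum, map_smul, φ_basis]
    refine Finset.sum_congr rfl fun k _ => ?_
    have : PowerSeries.C (c k) • β k = c k • β k := by
      rw [← PowerSeries.algebraMap_eq, algebraMap_smul]
    rw [this]
    rfl
  have hbij : Function.Bijective φ := by
    constructor
    · rw [injective_iff_map_eq_zero]
      intro a ha
      rw [← b.sum_repr a, φ_sum, Ideal.Quotient.eq_zero_iff_mem, hJ,
        Ideal.mem_span_singleton'] at ha
      obtain ⟨y, hy⟩ := ha
      refine b.ext_elem fun k => ?_
      have := congrArg (fun z => PowerSeries.constantCoeff (β.repr z k)) hy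
      rw [mul_comm, ← Algebra.smul_def] at this
      simpa [Finsupp.single_apply] using this.symm
    · intro z
      obtain ⟨x, rfl⟩ := Ideal.Quotient.mk_surjective z
      refine ⟨∑ k, PowerSeries.constantCoeff (β.repr x k) • b k, ?_⟩
      rw [φ_sum, Ideal.Quotient.mk_eq_mk_iff_sub_mem]
      nth_rw 2 [← β.sum_repr x]
      rw [← Finset.sum_sub_distrib]
      refine Ideal.sum_mem _ fun k _ => ?_
      rw [← sub_smul, Algebra.smul_def]
      refine Ideal.mul_mem_right _ _ (Ideal.mem_span_singleton.2 (map_dvd _ ?_))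
      rw [PowerSeries.X_dvd_iff]
      simp
  exact ⟨(AlgEquiv.ofBijective φ hbij).symm⟩

end Fiber

theorem isSmoothable_kleinIdeal (K : Type) [Field K] [CharZero K] :
    IsSmoothable K (MvPolynomial (Fin 5) K ⧸ kleinIdeal K) 12 := by
  obtain ⟨B, β, h⟩ := exists_isDeformed (PowerSeries K) (PowerSeries.X_ne_zero (R := K))
  have hinj := HahnSeries.ofPowerSeries_injective (Γ := ℤ) (R := K)
  have : CharZero (LaurentSeries K) := charZero_of_injective_ringHom
    (HahnSeries.C (Γ := ℤ) (R := K)).injective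
  refine ⟨B, inferInstance, inferInstance, inferInstance, inferInstance, .of_basis β,
    by simp [Module.finrank_eq_card_basis β], h.nonempty_fiber_algEquiv,
    h.etale_baseChange _ ?_⟩
  exact (map_ne_zero_iff (HahnSeries.ofPowerSeries ℤ K) hinj).2 PowerSeries.X_ne_zero

end KleinCubic

/-- Over an algebraically closed field `K` of characteristic `0`, there is a homogeneous ideal
`I ⊆ K[x₁,…,x₅]` whose quotient is graded Gorenstein with Hilbert function `(1,5,5,1)`,
is smoothable (with `d = 12`), and such that `Hom_R(I, R/I)` has `K`-dimension `112`. -/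
theorem exists_smooth_gorenstein_point_1551 (K : Type) [Field K] [IsAlgClosed K]
    [CharZero K] :
    ∃ I : Ideal (MvPolynomial (Fin 5) K),
      (∀ f ∈ I, ∀ d : ℕ, MvPolynomial.homogeneousComponent d f ∈ I) ∧
      Module.finrank K (gradedPiece K 5 I 0) = 1 ∧
      Module.finrank K (gradedPiece K 5 I 1) = 5 ∧
      Module.finrank K (gradedPiece K 5 I 2) = 5 ∧
      Module.finrank K (gradedPiece K 5 I 3) = 1 ∧
      (∀ t : ℕ, 4 ≤ t → Module.finrank K (gradedPiece K 5 I t) = 0) ∧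
      Module.finrank K (socle K 5 I) = 1 ∧
      IsSmoothable K (MvPolynomial (Fin 5) K ⧸ I) 12 ∧
      Module.finrank K (I →ₗ[MvPolynomial (Fin 5) K] (MvPolynomial (Fin 5) K ⧸ I)) = 60 := by
  open KleinCubic in
  refine ⟨kleinIdeal K, fun f hf d => homogeneousComponent_mem K f hf d, ?_, ?_, ?_, ?_,
    fun t ht => ?_, finrank_socle K, isSmoothable_kleinIdeal K, finrank_hom K⟩
  · rw [finrank_gradedPiece]; decide
  · rw [finrank_gradedPiece]; decide
  · rw [finrank_gradedPiece]; decide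
  · rw [finrank_gradedPiece]; decide
  · rw [finrank_gradedPiece, Fintype.card_eq_zero_iff]
    have hl : ∀ k, level k ≤ 3 := by decide
    exact ⟨fun k => by have := hl k; have := k.2; omega⟩
end

section
/- Let K be a field and R = K[x1,…,x7]. There are exactly 561 monomial ideals J ⊆ R that are strongly stable and satisfy dim_K R/J = 16. -/
open MvPolynomial

/-- A monomial ideal `J` is strongly stable if, for every monomial `xᵅ ∈ J` and indices
`i < k` with `x_i ∣ xᵅ`, the monomial `(xᵅ / x_i) · x_k` also lies in `J`. -/
def StronglyStable {n : ℕ} {K : Type} [Field K] (J : Ideal (MvPolynomial (Fin n) K)) : Prop :=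
  ∀ α : Fin n →₀ ℕ, (monomial α (1 : K)) ∈ J →
    ∀ i k : Fin n, i < k → α i ≠ 0 →
      (monomial (α - Finsupp.single i 1 + Finsupp.single k 1) (1 : K)) ∈ J

/-- An ideal of `K[x₁,…,xₙ]` is a monomial ideal if it is generated by monomials. -/
def IsMonomialIdeal {n : ℕ} {K : Type} [Field K] (J : Ideal (MvPolynomial (Fin n) K)) : Prop :=
  ∃ S : Set (Fin n →₀ ℕ), J = Ideal.span ((fun α => monomial α (1 : K)) '' S)

/-- The number of ways to extend the set of bits of `s` by `r` indices `t` among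
`i, …, i + ms.length - 1` such that every bit of the mask `ms[t - i]` of a new index `t` is
a bit of `s` or a new index. -/
def countExtensions : List ℕ → ℕ → ℕ → ℕ → ℕ
  | _, _, _, 0 => 1
  | [], _, _, _ + 1 => 0
  | m :: ms, i, s, r + 1 =>
    countExtensions ms (i + 1) s (r + 1) +
      if s &&& m = m then countExtensions ms (i + 1) (s ||| 2 ^ i) r else 0

theorem land_eq_right_iff (s m : ℕ) :
    s &&& m = m ↔ ∀ j, m.testBit j = true → s.testBit j = true := by
  constructor
  · intro h j hj
    rw [← h, Nat.testBit_and] at hj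
    simp_all
  · intro h
    refine Nat.eq_of_testBit_eq fun j => ?_
    rw [Nat.testBit_and]
    have := h j
    cases hm : m.testBit j <;> simp_all

open Classical in
theorem countExtensions_eq_card (ms : List ℕ) (i s r : ℕ)
    (hms : ∀ k < ms.length, ms.getD k 0 < 2 ^ (i + k)) :
    countExtensions ms i s r =
      ((Finset.Ico i (i + ms.length)).powerset.filter fun U : Finset ℕ => U.card = r ∧
        ∀ t ∈ U, ∀ j, (ms.getD (t - i) 0).testBit j = true →
          j ∈ U ∨ s.testBit j = true).card := by
  induction ms generalizing i s r with
  | nil =>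
    cases r with
    | zero => simp [countExtensions, Finset.filter_singleton]
    | succ r => simp [countExtensions, Finset.filter_singleton]
  | cons m ms ih =>
    cases r with
    | zero =>
      rw [countExtensions, eq_comm, Finset.card_eq_one]
      refine ⟨∅, ?_⟩
      ext U
      simp only [Finset.mem_filter, Finset.mem_powerset, Finset.card_eq_zero,
        Finset.mem_singleton]
      constructor
      · exact fun h => h.2.1
      · rintro rfl
        simp
    | succ r =>
      have hms' : ∀ k < ms.length, ms.getD k 0 < 2 ^ (i + 1 + k) := by
        intro k hk
        have := hms (k + 1) (by simpa using hk)
        simpa [add_assoc, add_comm 1 k] using this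
      have hm : ∀ j, m.testBit j = true → j < i := by
        intro j hj
        by_contra! hij
        have h0 : m < 2 ^ i := by simpa using hms 0 (by simp)
        have : m < 2 ^ j := h0.trans_le (Nat.pow_le_pow_right (by norm_num) hij)
        simp [Nat.testBit_lt_two_pow this] at hj
      have hIco : Finset.Ico i (i + (m :: ms).length) =
          insert i (Finset.Ico (i + 1) (i + 1 + ms.length)) := by
        ext x
        simp only [List.length_cons, Finset.mem_Ico, Finset.mem_insert]
        omega
      have hget : ∀ t, i + 1 ≤ t → (m :: ms).getD (t - i) 0 = ms.getD (t - (i + 1)) 0 := by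
        intro t ht
        obtain ⟨k, rfl⟩ := Nat.exists_eq_add_of_le ht
        rw [show i + 1 + k - i = k + 1 by omega, show i + 1 + k - (i + 1) = k by omega]
        rfl
      have hi : i ∉ Finset.Ico (i + 1) (i + 1 + ms.length) := by simp
      have hlow : ∀ U ∈ (Finset.Ico (i + 1) (i + 1 + ms.length)).powerset,
          ∀ t ∈ U, i + 1 ≤ t := fun U hU t ht =>
        (Finset.mem_Ico.1 (Finset.mem_powerset.1 hU ht)).1
      rw [countExtensions, hIco, Finset.powerset_insert, Finset.filter_union,
        Finset.card_union_of_disjoint]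
      · congr 1
        · rw [ih _ _ _ hms']
          congr 1
          refine Finset.filter_congr fun U hU => and_congr_right fun _ =>
            forall₂_congr fun t ht => ?_
          rw [hget t (hlow U hU t ht)]
        · rw [Finset.filter_image, Finset.card_image_of_injOn]
          · split_ifs with hsm
            · rw [ih _ _ _ hms']
              congr 1
              refine Finset.filter_congr fun U hU => ?_
              have hiU : i ∉ U := fun h => hi (Finset.mem_powerset.1 hU h)
              rw [Finset.card_insert_of_notMem hiU, Nat.add_right_cancel_iff,
                Finset.forall_mem_insert]
              refine and_congr_right fun _ => ?_
              rw [and_iff_right]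
              · refine forall₂_congr fun t ht => ?_
                rw [hget t (hlow U hU t ht)]
                refine forall₂_congr fun j _ => ?_
                rw [Nat.testBit_or, Nat.testBit_two_pow, Finset.mem_insert]
                simp only [Bool.or_eq_true, decide_eq_true_eq]
                tauto
              · intro j hj
                right
                exact (land_eq_right_iff s m).1 hsm j (by simpa using hj)
            · symm
              rw [Finset.card_eq_zero, Finset.filter_eq_empty_iff]
              rintro U hU ⟨-, h⟩
              refine hsm ((land_eq_right_iff s m).2 fun j hj => ?_)
              refine (h i (Finset.mem_insert_self _ _) j (by simpa using hj)).resolve_left ?_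
              intro hjU
              rcases Finset.mem_insert.1 hjU with rfl | hjU
              · exact (hm _ hj).false
              · have := hlow U hU j hjU
                have := hm j hj
                omega
          · intro U hU U' hU' h
            have hU := (Finset.mem_filter.1 (Finset.mem_coe.1 hU)).1
            have hU' := (Finset.mem_filter.1 (Finset.mem_coe.1 hU')).1
            have h1 : i ∉ U := fun h => hi (Finset.mem_powerset.1 hU h)
            have h2 : i ∉ U' := fun h => hi (Finset.mem_powerset.1 hU' h)
            rw [← Finset.erase_insert h1, ← Finset.erase_insert h2]
            exact congrArg (Finset.erase · i) h
      · refine Finset.disjoint_left.2 fun U hU hU' => ?_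
        have hU := (Finset.mem_filter.1 hU).1
        obtain ⟨W, -, rfl⟩ := Finset.mem_image.1 (Finset.mem_filter.1 hU').1
        exact hi (Finset.mem_powerset.1 hU (Finset.mem_insert_self _ _))

/-- Componentwise comparison of lists of the same length. -/
def listLE : List ℕ → List ℕ → Bool
  | [], [] => true
  | a :: l, b :: m => Nat.ble a b && listLE l m
  | _, _ => false

/-- The sums `α j + ⋯ + α 6`. They turn the strongly stable order on monomials into the
componentwise order. -/
def tailSums (α : Fin 7 →₀ ℕ) : List ℕ :=
  [α 0 + α 1 + α 2 + α 3 + α 4 + α 5 + α 6, α 1 + α 2 + α 3 + α 4 + α 5 + α 6,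
    α 2 + α 3 + α 4 + α 5 + α 6, α 3 + α 4 + α 5 + α 6, α 4 + α 5 + α 6, α 5 + α 6, α 6]

/-- The tail sums of the monomials with at most `16` predecessors in the strongly stable order. -/
def smallTails : List (List ℕ) :=
  [[0, 0, 0, 0, 0, 0, 0], [1, 0, 0, 0, 0, 0, 0], [2, 0, 0, 0, 0, 0, 0], [3, 0, 0, 0, 0, 0, 0],
   [4, 0, 0, 0, 0, 0, 0], [5, 0, 0, 0, 0, 0, 0], [6, 0, 0, 0, 0, 0, 0], [7, 0, 0, 0, 0, 0, 0],
   [8, 0, 0, 0, 0, 0, 0], [9, 0, 0, 0, 0, 0, 0], [10, 0, 0, 0, 0, 0, 0], [11, 0, 0, 0, 0, 0, 0],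
   [12, 0, 0, 0, 0, 0, 0], [13, 0, 0, 0, 0, 0, 0], [14, 0, 0, 0, 0, 0, 0], [15, 0, 0, 0, 0, 0, 0],
   [1, 1, 0, 0, 0, 0, 0], [2, 1, 0, 0, 0, 0, 0], [3, 1, 0, 0, 0, 0, 0], [4, 1, 0, 0, 0, 0, 0],
   [5, 1, 0, 0, 0, 0, 0], [6, 1, 0, 0, 0, 0, 0], [7, 1, 0, 0, 0, 0, 0], [2, 2, 0, 0, 0, 0, 0],
   [3, 2, 0, 0, 0, 0, 0], [4, 2, 0, 0, 0, 0, 0], [5, 2, 0, 0, 0, 0, 0], [3, 3, 0, 0, 0, 0, 0],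
   [4, 3, 0, 0, 0, 0, 0], [4, 4, 0, 0, 0, 0, 0], [1, 1, 1, 0, 0, 0, 0], [2, 1, 1, 0, 0, 0, 0],
   [3, 1, 1, 0, 0, 0, 0], [4, 1, 1, 0, 0, 0, 0], [5, 1, 1, 0, 0, 0, 0], [2, 2, 1, 0, 0, 0, 0],
   [3, 2, 1, 0, 0, 0, 0], [3, 3, 1, 0, 0, 0, 0], [2, 2, 2, 0, 0, 0, 0], [3, 2, 2, 0, 0, 0, 0],
   [1, 1, 1, 1, 0, 0, 0], [2, 1, 1, 1, 0, 0, 0], [3, 1, 1, 1, 0, 0, 0], [2, 2, 1, 1, 0, 0, 0],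
   [2, 2, 2, 1, 0, 0, 0], [2, 2, 2, 2, 0, 0, 0], [1, 1, 1, 1, 1, 0, 0], [2, 1, 1, 1, 1, 0, 0],
   [3, 1, 1, 1, 1, 0, 0], [2, 2, 1, 1, 1, 0, 0], [1, 1, 1, 1, 1, 1, 0], [2, 1, 1, 1, 1, 1, 0],
   [1, 1, 1, 1, 1, 1, 1], [2, 1, 1, 1, 1, 1, 1]]

/-- Bit `j` of entry `i` tells whether `smallTails[j]` lies strictly below `smallTails[i]`. -/
def predecessorMasks : List ℕ :=
  [0, 1, 3, 7, 15,
   31, 63, 127, 255, 511,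
   1023, 2047, 4095, 8191, 16383,
   32767, 3, 65543, 196623, 458783,
   983103, 2031743, 4129023, 196615, 8847375,
   26148895, 60751935, 25624591, 193921055, 462356511,
   65539, 1073938439, 3221684239, 7517175839, 16108159039,
   3229810695, 41901555727, 110755250191, 37589549063, 385498939407,
   1073807363, 1102733049863, 3306051534863, 3336124432391, 12407095361543,
   29999281405959, 1100585435139, 73670500483079, 218810330578959, 223238449987591,
   71469329612803, 1340307895681031, 1197369236455427, 8095707336736775]

/-- Addition of `1` to the first `i + 1` entries. -/
def incrementUpTo (i : ℕ) (l : List ℕ) : List ℕ :=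
  (l.take (i + 1)).map (· + 1) ++ l.drop (i + 1)

/-- The exponent vector with tail sums `l`. -/
noncomputable def ofTailSums (l : List ℕ) : Fin 7 →₀ ℕ :=
  Finsupp.equivFunOnFinite.symm fun i => l.getD i 0 - l.getD (i + 1) 0

/-- Whether `l` is weakly decreasing. -/
def isDecreasing : List ℕ → Bool
  | a :: b :: l => Nat.ble b a && isDecreasing (b :: l)
  | _ => true

theorem countExtensions_predecessorMasks :
    countExtensions predecessorMasks 0 0 16 = 561 := by
  decide +kernel

theorem predecessorMasks_lt :
    ∀ k < predecessorMasks.length, predecessorMasks.getD k 0 < 2 ^ (0 + k) := by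
  decide +kernel

theorem predecessorMasks_testBit : ∀ i < 54, ∀ j < 54,
    (predecessorMasks.getD i 0).testBit j =
      (!decide (j = i) && listLE (smallTails.getD j []) (smallTails.getD i [])) := by
  decide +kernel

theorem smallTails_nodup : smallTails.Nodup := by
  decide +kernel

theorem smallTails_valid : ∀ l ∈ smallTails, l.length = 7 ∧ isDecreasing l = true := by
  decide +kernel

theorem smallTails_increment : ∀ l ∈ smallTails, ∀ i < 7, incrementUpTo i l ∈ smallTails ∨
    16 ≤ (smallTails.filter fun m => listLE m (incrementUpTo i l)).length := by
  decide +kernel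

theorem smallTails_decrement : ∀ l ∈ smallTails, ∀ j < 7,
    isDecreasing (l.modify j (· - 1)) = true → l.modify j (· - 1) ∈ smallTails := by
  decide +kernel

open Classical in
theorem card_filter_predecessors :
    ((Finset.range 54).powerset.filter fun U : Finset ℕ => U.card = 16 ∧
      ∀ t ∈ U, ∀ j < 54, listLE (smallTails.getD j []) (smallTails.getD t []) = true →
        j ∈ U).card = 561 := by
  rw [← countExtensions_predecessorMasks,
    countExtensions_eq_card _ _ _ _ predecessorMasks_lt]
  refine congrArg Finset.card ?_
  rw [Finset.range_eq_Ico, show 0 + predecessorMasks.length = 54 from rfl]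
  ext U
  simp only [Finset.mem_filter]
  refine and_congr_right fun hU => and_congr_right fun _ => forall₂_congr fun t ht => ?_
  have ht54 : t < 54 := (Finset.mem_Ico.1 (Finset.mem_powerset.1 hU ht)).2
  constructor
  · intro h j hj
    have hj54 : j < 54 := by
      by_contra! hle
      have := (predecessorMasks_lt t ht54).trans_le
        (Nat.pow_le_pow_right (by norm_num) (show 0 + t ≤ j by omega))
      rw [Nat.sub_zero, Nat.testBit_lt_two_pow this] at hj
      exact Bool.false_ne_true hj
    rw [Nat.sub_zero, predecessorMasks_testBit t ht54 j hj54, Bool.and_eq_true] at hj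
    exact Or.inl (h j hj54 hj.2)
  · intro h j hj54 hle
    rcases eq_or_ne j t with rfl | hne
    · exact ht
    · refine (h j ?_).resolve_right (by simp)
      rw [Nat.sub_zero, predecessorMasks_testBit t ht54 j hj54, hle]
      simpa using hne

theorem tailSums_injective : Function.Injective tailSums := by
  intro α β h
  simp only [tailSums, List.cons.injEq, and_true] at h
  ext i
  fin_cases i <;> simp <;> omega

theorem listLE_tailSums_of_le {α β : Fin 7 →₀ ℕ} (h : α ≤ β) :
    listLE (tailSums α) (tailSums β) = true := by
  have h0 := h 0
  have h1 := h 1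
  have h2 := h 2
  have h3 := h 3
  have h4 := h 4
  have h5 := h 5
  have h6 := h 6
  simp only [listLE, tailSums, Bool.and_eq_true, Nat.ble_eq, and_true]
  omega

theorem listLE_tailSums_move (α : Fin 7 →₀ ℕ) {i k : Fin 7} (hik : i < k) (hα : α i ≠ 0) :
    listLE (tailSums α) (tailSums (α - Finsupp.single i 1 + Finsupp.single k 1)) = true := by
  simp only [listLE, tailSums, Bool.and_eq_true, Nat.ble_eq, and_true, Finsupp.add_apply,
    Finsupp.tsub_apply, Finsupp.single_apply]
  fin_cases i <;> fin_cases k <;> simp at hik hα ⊢ <;> omega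

theorem isDecreasing_tailSums (α : Fin 7 →₀ ℕ) : isDecreasing (tailSums α) = true := by
  simp only [isDecreasing, tailSums, Bool.and_eq_true, Nat.ble_eq, and_true]
  omega

theorem tailSums_ofTailSums {l : List ℕ} (hl : l.length = 7) (hd : isDecreasing l = true) :
    tailSums (ofTailSums l) = l := by
  obtain ⟨a, b, c, d, e, f, g, rfl⟩ : ∃ a b c d e f g, l = [a, b, c, d, e, f, g] := by
    match l, hl with
    | [a, b, c, d, e, f, g], _ => exact ⟨a, b, c, d, e, f, g, rfl⟩
  simp only [isDecreasing, Bool.and_eq_true, Nat.ble_eq, and_true] at hd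
  simp [tailSums, ofTailSums]
  omega

theorem tailSums_add_single (α : Fin 7 →₀ ℕ) (i : Fin 7) :
    tailSums (α + Finsupp.single i 1) = incrementUpTo i (tailSums α) := by
  fin_cases i <;> simp [tailSums, incrementUpTo] <;> omega

/-- A property preserved by the covering relations of the strongly stable order is preserved
when passing to a larger monomial. -/
theorem of_listLE_tailSums {P : (Fin 7 →₀ ℕ) → Prop}
    (hP : ∀ j < 7, ∀ α β, tailSums β = (tailSums α).modify j (· + 1) → P α → P β)
    {α β : Fin 7 →₀ ℕ} (h : listLE (tailSums α) (tailSums β) = true) (hα : P α) : P β := by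
  induction hd : (tailSums β).sum - (tailSums α).sum using Nat.strong_induction_on
    generalizing α with
  | _ d ih =>
    have key : ∀ j < 7, isDecreasing ((tailSums α).modify j (· + 1)) = true →
        listLE ((tailSums α).modify j (· + 1)) (tailSums β) = true →
        (tailSums β).sum - ((tailSums α).modify j (· + 1)).sum < d → P β := by
      intro j hj hdec hle hlt
      have hγ := tailSums_ofTailSums (l := (tailSums α).modify j (· + 1))
        (by simp [tailSums]) hdec
      exact ih _ (by rwa [hγ]) (by rwa [hγ]) (hP j hj _ _ hγ hα) rfl
    by_cases heq : tailSums α = tailSums β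
    · exact tailSums_injective heq ▸ hα
    have hαd := isDecreasing_tailSums α
    have hβd := isDecreasing_tailSums β
    revert h heq key hαd hβd hd
    obtain ⟨a0, a1, a2, a3, a4, a5, a6, ha⟩ :
        ∃ a b c d e f g, tailSums α = [a, b, c, d, e, f, g] := ⟨_, _, _, _, _, _, _, rfl⟩
    obtain ⟨b0, b1, b2, b3, b4, b5, b6, hb⟩ :
        ∃ a b c d e f g, tailSums β = [a, b, c, d, e, f, g] := ⟨_, _, _, _, _, _, _, rfl⟩
    rw [ha, hb]
    intro h hd key heq hαd hβd
    simp only [listLE, isDecreasing, Bool.and_eq_true, Nat.ble_eq, and_true] at h hαd hβd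
    simp only [List.sum_cons, List.sum_nil] at hd
    by_cases h0 : a0 < b0
    · exact key 0 (by norm_num) (by simp [isDecreasing]; omega) (by simp [listLE]; omega)
        (by simp; omega)
    by_cases h1 : a1 < b1
    · exact key 1 (by norm_num) (by simp [isDecreasing]; omega) (by simp [listLE]; omega)
        (by simp; omega)
    by_cases h2 : a2 < b2
    · exact key 2 (by norm_num) (by simp [isDecreasing]; omega) (by simp [listLE]; omega)
        (by simp; omega)
    by_cases h3 : a3 < b3
    · exact key 3 (by norm_num) (by simp [isDecreasing]; omega) (by simp [listLE]; omega)
        (by simp; omega)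
    by_cases h4 : a4 < b4
    · exact key 4 (by norm_num) (by simp [isDecreasing]; omega) (by simp [listLE]; omega)
        (by simp; omega)
    by_cases h5 : a5 < b5
    · exact key 5 (by norm_num) (by simp [isDecreasing]; omega) (by simp [listLE]; omega)
        (by simp; omega)
    by_cases h6 : a6 < b6
    · exact key 6 (by norm_num) (by simp [isDecreasing]; omega) (by simp [listLE]; omega)
        (by simp; omega)
    exact absurd (by simp; omega) heq

section Ideals

variable {K : Type} [Field K]

theorem IsMonomialIdeal.mem_iff {n : ℕ} {J : Ideal (MvPolynomial (Fin n) K)}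
    (hJ : IsMonomialIdeal J) (f : MvPolynomial (Fin n) K) :
    f ∈ J ↔ ∀ α ∈ f.support, monomial α (1 : K) ∈ J := by
  obtain ⟨S, rfl⟩ := hJ
  rw [mem_ideal_span_monomial_image]
  refine forall₂_congr fun α _ => ?_
  rw [mem_ideal_span_monomial_image]
  classical simp [support_monomial]

theorem monomial_mem_of_le {n : ℕ} {J : Ideal (MvPolynomial (Fin n) K)} {α β : Fin n →₀ ℕ}
    (h : α ≤ β) (hα : monomial α (1 : K) ∈ J) : monomial β (1 : K) ∈ J := by
  have := J.mul_mem_left (monomial (β - α) 1) hα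
  rwa [monomial_mul, tsub_add_cancel_of_le h, one_mul] at this

/-- The monomials outside a monomial ideal form a basis of the quotient. -/
theorem IsMonomialIdeal.finrank_quotient {n : ℕ} {J : Ideal (MvPolynomial (Fin n) K)}
    (hJ : IsMonomialIdeal J) :
    Module.finrank K (MvPolynomial (Fin n) K ⧸ J) =
      {α : Fin n →₀ ℕ | monomial α (1 : K) ∉ J}.ncard := by
  classical
  set N := {α : Fin n →₀ ℕ | monomial α (1 : K) ∉ J}
  let L : MvPolynomial (Fin n) K →ₗ[K] (N →₀ K) :=
    Finsupp.lsubtypeDomain N ∘ₗ (basisMonomials (Fin n) K).repr.toLinearMap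
  have hL : ∀ f (α : N), L f α = coeff α f := fun f α => rfl
  have hker : LinearMap.ker L = J.restrictScalars K := by
    ext f
    rw [LinearMap.mem_ker, Submodule.restrictScalars_mem, hJ.mem_iff, DFunLike.ext_iff]
    constructor
    · intro h α hα
      by_contra hαN
      exact mem_support_iff.1 hα (h ⟨α, hαN⟩)
    · rintro h ⟨α, hα⟩
      by_contra h0
      exact hα (h α (mem_support_iff.2 h0))
  have hsurj : Function.Surjective L := fun g =>
    ⟨(basisMonomials (Fin n) K).repr.symm g.extendDomain, by
      change Finsupp.subtypeDomain (· ∈ N)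
        ((basisMonomials (Fin n) K).repr ((basisMonomials (Fin n) K).repr.symm _)) = g
      rw [LinearEquiv.apply_symm_apply]
      exact Finsupp.subtypeDomain_extendDomain g⟩
  rw [← (Submodule.Quotient.restrictScalarsEquiv K J).finrank_eq, ← hker,
    (L.quotKerEquivOfSurjective hsurj).finrank_eq, ← Nat.card_coe_set_eq]
  rcases finite_or_infinite N with h | h
  · have := Fintype.ofFinite N
    rw [Module.finrank_finsupp_self, Nat.card_eq_fintype_card]
  · rw [Nat.card_eq_zero_of_infinite]
    exact (Finsupp.basisSingleOne (R := K) (ι := N)).linearIndependent.finrank_eq_zero_of_infinite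

theorem StronglyStable.monomial_mem {J : Ideal (MvPolynomial (Fin 7) K)}
    (hJ : StronglyStable J) {α β : Fin 7 →₀ ℕ}
    (h : listLE (tailSums α) (tailSums β) = true) (hα : monomial α (1 : K) ∈ J) :
    monomial β (1 : K) ∈ J := by
  refine of_listLE_tailSums (P := fun γ => monomial γ (1 : K) ∈ J) ?_ h hα
  intro j hj α β hβ hα
  have hmove : ∀ i k : Fin 7, i < k → α i ≠ 0 →
      β = α - Finsupp.single i 1 + Finsupp.single k 1 → monomial β (1 : K) ∈ J := by
    rintro i k hik hi rfl
    exact hJ α hα i k hik hi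
  have hext : ∀ γ : Fin 7 →₀ ℕ, (β 0 = γ 0 ∧ β 1 = γ 1 ∧ β 2 = γ 2 ∧ β 3 = γ 3 ∧ β 4 = γ 4 ∧
      β 5 = γ 5 ∧ β 6 = γ 6) → β = γ := by
    intro γ h
    ext i
    fin_cases i <;> simp [h]
  interval_cases j <;> simp [tailSums] at hβ
  · exact monomial_mem_of_le (Finsupp.le_def.2 fun i => by fin_cases i <;> simp <;> omega) hα
  · exact hmove 0 1 (by decide) (by omega) (hext _ (by simp; omega))
  · exact hmove 1 2 (by decide) (by omega) (hext _ (by simp; omega))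
  · exact hmove 2 3 (by decide) (by omega) (hext _ (by simp; omega))
  · exact hmove 3 4 (by decide) (by omega) (hext _ (by simp; omega))
  · exact hmove 4 5 (by decide) (by omega) (hext _ (by simp; omega))
  · exact hmove 5 6 (by decide) (by omega) (hext _ (by simp; omega))

theorem tailSums_ofTailSums_of_mem {l : List ℕ} (hl : l ∈ smallTails) :
    tailSums (ofTailSums l) = l :=
  tailSums_ofTailSums (smallTails_valid l hl).1 (smallTails_valid l hl).2

theorem StronglyStable.tailSums_mem_smallTails {J : Ideal (MvPolynomial (Fin 7) K)}
    (hJ : StronglyStable J)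
    (hcard : {α : Fin 7 →₀ ℕ | monomial α (1 : K) ∉ J}.ncard = 16)
    {α : Fin 7 →₀ ℕ} (hα : monomial α (1 : K) ∉ J) : tailSums α ∈ smallTails := by
  induction hd : α.degree generalizing α with
  | zero =>
    rw [Finsupp.degree_eq_zero_iff] at hd
    subst hd
    simp [tailSums, smallTails]
  | succ d ih =>
    obtain ⟨i, hi⟩ : ∃ i, α i ≠ 0 := by
      by_contra! h
      rw [show α = 0 from Finsupp.ext h] at hd
      simp at hd
    have hαi : α - Finsupp.single i 1 + Finsupp.single i 1 = α :=
      tsub_add_cancel_of_le (by simpa [Nat.one_le_iff_ne_zero] using hi)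
    have hdeg : (α - Finsupp.single i 1).degree = d := by
      rw [← hαi, map_add, Finsupp.degree_single] at hd
      omega
    have hmem := ih (fun h => hα (monomial_mem_of_le tsub_le_self h)) hdeg
    have htail := tailSums_add_single (α - Finsupp.single i 1) i
    rw [hαi] at htail
    by_contra hnot
    have hlen := (smallTails_increment _ hmem i i.2).resolve_left (htail ▸ hnot)
    rw [← htail] at hlen
    set l := smallTails.filter fun m => listLE m (tailSums α)
    have hnodup : l.Nodup := smallTails_nodup.filter _
    have hsub : ((insert (tailSums α) l.toFinset : Finset (List ℕ)) : Set (List ℕ)) ⊆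
        tailSums '' {α : Fin 7 →₀ ℕ | monomial α (1 : K) ∉ J} := by
      intro m hm
      rcases Finset.mem_insert.1 (Finset.mem_coe.1 hm) with rfl | hm
      · exact ⟨α, hα, rfl⟩
      · obtain ⟨hms, hle⟩ := List.mem_filter.1 (List.mem_toFinset.1 hm)
        have hm' := tailSums_ofTailSums_of_mem hms
        exact ⟨ofTailSums m, fun h => hα (hJ.monomial_mem (by rwa [hm']) h), hm'⟩
    have hfin : {α : Fin 7 →₀ ℕ | monomial α (1 : K) ∉ J}.Finite :=
      Set.finite_of_ncard_ne_zero (by omega)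
    have hle := Set.ncard_le_ncard hsub (hfin.image _)
    rw [Set.ncard_coe_finset, Set.ncard_image_of_injective _ tailSums_injective, hcard,
      Finset.card_insert_of_notMem fun h =>
        hnot (List.mem_filter.1 (List.mem_toFinset.1 h)).1,
      List.toFinset_card_of_nodup hnodup] at hle
    omega

end Ideals

/-- The exponent vector with tail sums `smallTails[i]`. -/
noncomputable def smallExponent (i : ℕ) : Fin 7 →₀ ℕ :=
  ofTailSums (smallTails.getD i [])

theorem getD_mem_smallTails {i : ℕ} (hi : i < 54) : smallTails.getD i [] ∈ smallTails := by
  rw [List.getD_eq_getElem _ _ (show i < smallTails.length from hi)]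
  exact List.getElem_mem _

theorem tailSums_smallExponent {i : ℕ} (hi : i < 54) :
    tailSums (smallExponent i) = smallTails.getD i [] :=
  tailSums_ofTailSums_of_mem (getD_mem_smallTails hi)

theorem exists_smallExponent_eq {α : Fin 7 →₀ ℕ} (h : tailSums α ∈ smallTails) :
    ∃ i < 54, smallExponent i = α := by
  obtain ⟨i, hi, heq⟩ := List.getElem_of_mem h
  refine ⟨i, hi, tailSums_injective ?_⟩
  rw [tailSums_smallExponent hi, ← heq, List.getD_eq_getElem _ _ hi]

theorem smallExponent_injOn : Set.InjOn smallExponent (Finset.range 54 : Finset ℕ) := by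
  intro i hi j hj h
  have hi : i < smallTails.length := Finset.mem_range.1 hi
  have hj : j < smallTails.length := Finset.mem_range.1 hj
  have := congrArg tailSums h
  rw [tailSums_smallExponent hi, tailSums_smallExponent hj, List.getD_eq_getElem _ _ hi,
    List.getD_eq_getElem _ _ hj] at this
  exact (smallTails_nodup.getElem_inj_iff).1 this

/-- A set of small monomials which is closed under predecessors has an upward closed
complement. -/
theorem notMem_image_smallExponent {U : Finset ℕ} (hU : U ⊆ Finset.range 54)
    (hclosed : ∀ t ∈ U, ∀ j < 54,
      listLE (smallTails.getD j []) (smallTails.getD t []) = true → j ∈ U)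
    {α β : Fin 7 →₀ ℕ} (h : listLE (tailSums α) (tailSums β) = true)
    (hα : α ∉ smallExponent '' (U : Set ℕ)) : β ∉ smallExponent '' (U : Set ℕ) := by
  refine of_listLE_tailSums (P := fun γ => γ ∉ smallExponent '' (U : Set ℕ)) ?_ h hα
  rintro j hj α β hβ hα ⟨t, ht, rfl⟩
  have ht54 : t < 54 := Finset.mem_range.1 (hU ht)
  have hdec : tailSums α = (tailSums (smallExponent t)).modify j (· - 1) := by
    rw [hβ]
    interval_cases j <;> simp [tailSums]
  have hle : listLE (tailSums α) (tailSums (smallExponent t)) = true := by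
    rw [hβ]
    interval_cases j <;> simp [tailSums, listLE]
  rw [tailSums_smallExponent ht54] at hdec
  obtain ⟨k, hk, rfl⟩ := exists_smallExponent_eq (α := α) (by
    rw [hdec]
    refine smallTails_decrement _ (getD_mem_smallTails ht54) j hj ?_
    rw [← hdec]
    exact isDecreasing_tailSums α)
  rw [tailSums_smallExponent ht54, tailSums_smallExponent hk] at hle
  exact hα ⟨k, hclosed t ht k hk hle, rfl⟩

/-- There are exactly `561` strongly stable monomial ideals `J ⊆ K[x₁,…,x₇]` with
`dim_K K[x₁,…,x₇]/J = 16`. -/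
theorem card_stronglyStable_colength16 (K : Type) [Field K] :
    {J : Ideal (MvPolynomial (Fin 7) K) |
      IsMonomialIdeal J ∧ StronglyStable J ∧
      Module.finrank K (MvPolynomial (Fin 7) K ⧸ J) = 16}.ncard = 561 := by
  classical
  set 𝒥 := {J : Ideal (MvPolynomial (Fin 7) K) |
      IsMonomialIdeal J ∧ StronglyStable J ∧
      Module.finrank K (MvPolynomial (Fin 7) K ⧸ J) = 16}
  let F : Ideal (MvPolynomial (Fin 7) K) → Finset ℕ := fun J =>
    (Finset.range 54).filter fun i => monomial (smallExponent i) (1 : K) ∉ J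
  have hF : ∀ J ∈ 𝒥, {α : Fin 7 →₀ ℕ | monomial α (1 : K) ∉ J} =
      smallExponent '' (F J : Set ℕ) := by
    rintro J ⟨hmon, hst, hrank⟩
    rw [hmon.finrank_quotient] at hrank
    ext α
    constructor
    · intro hα
      obtain ⟨i, hi, rfl⟩ := exists_smallExponent_eq (hst.tailSums_mem_smallTails hrank hα)
      exact ⟨i, Finset.mem_filter.2 ⟨Finset.mem_range.2 hi, hα⟩, rfl⟩
    · rintro ⟨i, hi, rfl⟩
      exact (Finset.mem_filter.1 hi).2
  have hcard : ∀ U ⊆ Finset.range 54, (smallExponent '' (U : Set ℕ)).ncard = U.card := by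
    intro U hU
    rw [(smallExponent_injOn.mono (Finset.coe_subset.2 hU)).ncard_image,
      Set.ncard_coe_finset]
  have hinj : Set.InjOn F 𝒥 := by
    intro J hJ J' hJ' h
    have hN := (hF J hJ).trans ((congrArg _ (congrArg _ h)).trans (hF J' hJ').symm)
    ext f
    rw [hJ.1.mem_iff, hJ'.1.mem_iff]
    exact forall₂_congr fun α _ => not_iff_not.1 (Set.ext_iff.1 hN α)
  rw [← card_filter_predecessors, ← hinj.ncard_image, ← Set.ncard_coe_finset]
  congr 1
  ext U
  simp only [Finset.coe_filter, Finset.mem_powerset, Set.mem_ofPred_eq]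
  constructor
  · rintro ⟨J, hJ, rfl⟩
    have hsub : F J ⊆ Finset.range 54 := Finset.filter_subset _ _
    refine ⟨hsub, ?_, fun t ht j hj hle => ?_⟩
    · rw [← hcard _ hsub, ← hF J hJ, ← hJ.1.finrank_quotient, hJ.2.2]
    · obtain ⟨ht54, ht⟩ := Finset.mem_filter.1 ht
      refine Finset.mem_filter.2 ⟨Finset.mem_range.2 hj, fun h => ht (hJ.2.1.monomial_mem ?_ h)⟩
      rwa [tailSums_smallExponent hj, tailSums_smallExponent (Finset.mem_range.1 ht54)]
  · rintro ⟨hU, hU16, hclosed⟩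
    set J : Ideal (MvPolynomial (Fin 7) K) := Ideal.span
      ((fun α => monomial α (1 : K)) '' {α | α ∉ smallExponent '' (U : Set ℕ)})
    have hmem : ∀ α, monomial α (1 : K) ∈ J ↔ α ∉ smallExponent '' (U : Set ℕ) := by
      intro α
      rw [mem_ideal_span_monomial_image, support_monomial, if_neg one_ne_zero]
      simp only [Finset.mem_singleton, forall_eq]
      constructor
      · rintro ⟨β, hβ, hle⟩
        exact notMem_image_smallExponent hU hclosed (listLE_tailSums_of_le hle) hβ
      · exact fun h => ⟨α, h, le_rfl⟩
    have hmon : IsMonomialIdeal J := ⟨_, rfl⟩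
    refine ⟨J, ⟨hmon, ?_, ?_⟩, ?_⟩
    · intro α hα i k hik hi
      rw [hmem] at hα ⊢
      exact notMem_image_smallExponent hU hclosed (listLE_tailSums_move α hik hi) hα
    · rw [hmon.finrank_quotient, ← hU16, ← hcard U hU]
      congr 1
      ext α
      simp only [Set.mem_ofPred_eq, hmem, not_not]
    · ext i
      rw [Finset.mem_filter, hmem, not_not]
      constructor
      · rintro ⟨hi, j, hj, hij⟩
        rwa [← smallExponent_injOn (Finset.coe_subset.2 hU hj) (Finset.mem_coe.2 hi) hij]
      · exact fun hi => ⟨hU hi, i, hi, rfl⟩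
end
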